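/- arXiv:1701.08826 — 5 statements merged into one kernel-verified Lean document; each statement's English description precedes it below -/
import Mathlib

section
/- Two n×n complex matrices A and B are unitarily similar (i.e., B = U⁻¹AU for some unitary matrix U) if and only if trace w(A, Aᴴ) = trace w(B, Bᴴ) for every word w(x,y) in two noncommuting variables, where Aᴴ denotes the conjugate transpose. Concretely: there exists a unitary U with B = U⁻¹AU if and only if for every nonempty finite list ε₁,…,ε_ℓ of symbols from {1,*}, trace(A^{(ε₁)}···A^{(ε_ℓ)}) = trace(B^{(ε₁)}···B^{(ε_ℓ)}), where M^{(1)} = M and M^{(*)} = Mᴴ. -/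
open Matrix

section

open scoped ComplexOrder

variable {m : Type*} [Fintype m] [DecidableEq m]

/-- A nonzero space of pairs of matrices, closed under products and conjugate transposes and on
which the two traces agree, admits a nonzero intertwiner from the first to the second component. -/
lemma exists_ne_zero_intertwiner (T : Submodule ℂ (Matrix m m ℂ × Matrix m m ℂ)) (hT : T ≠ ⊥)
    (hmul : ∀ x ∈ T, ∀ y ∈ T, x * y ∈ T) (hstar : ∀ x ∈ T, star x ∈ T)
    (htr : ∀ x ∈ T, x.1.trace = x.2.trace) {P Q : Matrix m m ℂ}
    (hP : ∀ x ∈ T, x.1 * P = x.1) (hQ : ∀ x ∈ T, Q * x.2 = x.2) :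
    ∃ Z : Matrix m m ℂ, Z ≠ 0 ∧ Z * P = Z ∧ Q * Z = Z ∧ ∀ x ∈ T, x.2 * Z = Z * x.1 := by
  have hfst : ∀ x ∈ T, x.1 = 0 → x = 0 := fun x hx h ↦ by
    have := htr _ (hmul _ (hstar x hx) x hx)
    simp only [Prod.fst_mul, Prod.snd_mul, Prod.fst_star, Prod.snd_star, h, mul_zero, trace_zero,
      star_eq_conjTranspose] at this
    exact Prod.ext h (trace_conjTranspose_mul_self_eq_zero_iff.1 this.symm)
  have hsnd : ∀ x ∈ T, x.2 = 0 → x = 0 := fun x hx h ↦ by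
    have := htr _ (hmul _ (hstar x hx) x hx)
    simp only [Prod.fst_mul, Prod.snd_mul, Prod.fst_star, Prod.snd_star, h, mul_zero, trace_zero,
      star_eq_conjTranspose] at this
    exact Prod.ext (trace_conjTranspose_mul_self_eq_zero_iff.1 this) h
  let B : LinearMap.BilinForm ℂ T := LinearMap.mk₂ ℂ (fun x y ↦ (x.1.1 * y.1.1).trace)
    (by simp [add_mul]) (by simp) (by simp [mul_add]) (by simp)
  have hB (x y : T) : B x y = (x.1.1 * y.1.1).trace := rfl
  have hsymm : B.IsSymm := ⟨fun x y ↦ trace_mul_comm x.1.1 y.1.1⟩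
  have hnd : B.Nondegenerate := by
    refine hsymm.isRefl.nondegenerate_iff_separatingLeft.2 fun x hx ↦ ?_
    have := hx ⟨star x.1, hstar _ x.2⟩
    rw [hB] at this
    exact Subtype.ext (hfst _ x.2 (trace_mul_conjTranspose_self_eq_zero_iff.1 this))
  let b := Module.finBasis ℂ T
  let d := B.dualBasis hnd b
  have hb (x : T) : x = ∑ i, B x (d i) • b i := by
    have := b.sum_repr x
    conv_lhs => rw [← this]
    refine Finset.sum_congr rfl fun i _ ↦ ?_
    rw [← LinearMap.BilinForm.dualBasis_dualBasis hnd hsymm b,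
      LinearMap.BilinForm.dualBasis_repr_apply,
      LinearMap.BilinForm.dualBasis_dualBasis hnd hsymm b]
  have hd (x : T) : x = ∑ i, B x (b i) • d i := by
    conv_lhs => rw [← d.sum_repr x]
    simp only [d, LinearMap.BilinForm.dualBasis_repr_apply]
  let Z (M : Matrix m m ℂ) := ∑ i, (b i).1.2 * M * (d i).1.1
  obtain ⟨M, hM⟩ : ∃ M, Z M ≠ 0 := by
    by_contra! h
    have : Nontrivial T := Submodule.nontrivial_iff_ne_bot.2 hT
    obtain ⟨i⟩ := b.index_nonempty
    refine d.ne_zero i (Subtype.ext (hfst _ (d i).2 ?_))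
    ext l q
    have hsum : ∑ i, (d i).1.1 l q • b i = 0 := by
      refine Subtype.ext (hsnd _ (Subtype.mem _) ?_)
      ext p k
      have := congrFun₂ (h (single k l 1)) p q
      simp only [Z, Matrix.sum_apply, Matrix.zero_apply] at this
      simp only [AddSubmonoidClass.coe_finsetSum, Submodule.coe_smul, Prod.snd_sum, Prod.smul_snd,
        Matrix.sum_apply, Matrix.smul_apply, smul_eq_mul, Matrix.zero_apply]
      rw [← this]
      refine Finset.sum_congr rfl fun i _ ↦ ?_
      rw [mul_assoc, mul_apply, Finset.sum_eq_single k]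
      · simp [mul_comm]
      · intro j _ hj
        rw [single_mul_apply_of_ne _ _ _ _ _ hj, mul_zero]
      · simp
    exact Fintype.linearIndependent_iff.1 b.linearIndependent _ hsum i
  refine ⟨Z M, hM, ?_, ?_, fun x hx ↦ ?_⟩
  · simp only [Z, Finset.sum_mul, mul_assoc, hP _ (d _).2]
  · simp only [Z, Finset.mul_sum, ← mul_assoc, hQ _ (b _).2]
  · have h1 (i) : x.2 * (b i).1.2 = ∑ j, (x.1 * (b i).1.1 * (d j).1.1).trace • (b j).1.2 := by
      have := congrArg (fun y : T ↦ y.1.2) (hb ⟨x * (b i).1, hmul _ hx _ (b i).2⟩)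
      simpa [hB, Prod.snd_sum] using this
    have h2 (j) : (d j).1.1 * x.1 = ∑ i, (x.1 * (b i).1.1 * (d j).1.1).trace • (d i).1.1 := by
      have := congrArg (fun y : T ↦ y.1.1) (hd ⟨(d j).1 * x, hmul _ (d j).2 _ hx⟩)
      simp only [hB, AddSubmonoidClass.coe_finsetSum, Submodule.coe_smul, Prod.fst_sum,
        Prod.smul_fst, Prod.fst_mul] at this
      rw [this]
      refine Finset.sum_congr rfl fun i _ ↦ ?_
      rw [mul_assoc, trace_mul_comm]
    simp only [Z, Finset.mul_sum, Finset.sum_mul, mul_assoc, h2]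
    simp only [← mul_assoc, h1, Finset.sum_mul, smul_mul_assoc, mul_smul_comm]
    exact Finset.sum_comm

/-- Every nonzero matrix becomes a nonzero partial isometry after multiplication on the right by
a matrix `F` commuting with the commutant of `Zᴴ * Z`. -/
lemma exists_partialIsometry_mul {Z : Matrix m m ℂ} (hZ : Z ≠ 0) :
    ∃ F : Matrix m m ℂ, (∀ X, Commute (Zᴴ * Z) X → Commute F X) ∧ Z * F ≠ 0 ∧
      Z * F * (Z * F)ᴴ * (Z * F) = Z * F := by
  have hps := posSemidef_conjTranspose_mul_self Z
  have hH : IsSelfAdjoint (Zᴴ * Z) := hps.1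
  set H := Zᴴ * Z
  have hspec : ∀ t ∈ spectrum ℝ H, 0 ≤ t := by
    rw [hps.1.spectrum_real_eq_range_eigenvalues]
    rintro _ ⟨i, rfl⟩
    exact hps.eigenvalues_nonneg i
  have hfin : (spectrum ℝ H).Finite := by
    rw [hps.1.spectrum_real_eq_range_eigenvalues]
    exact Set.finite_range _
  have hc (g : ℝ → ℝ) : ContinuousOn g (spectrum ℝ H) := hfin.continuousOn g
  let f : ℝ → ℝ := fun t ↦ (√t)⁻¹
  have hFs : (cfc f H)ᴴ = cfc f H := cfc_predicate (R := ℝ) f H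
  have hFHF : cfc f H * H * cfc f H * cfc f H = cfc f H := by
    conv_lhs => enter [1, 1, 2]; rw [← cfc_id ℝ H]
    rw [← cfc_mul _ _ H (hc _) (hc _), ← cfc_mul _ _ H (hc _) (hc _),
      ← cfc_mul _ _ H (hc _) (hc _)]
    refine cfc_congr fun t ht ↦ ?_
    rcases eq_or_ne t 0 with rfl | h0
    · simp [f]
    · have h1 := Real.mul_self_sqrt (hspec t ht)
      have h2 : √t ≠ 0 := by simpa [Real.sqrt_eq_zero (hspec t ht)] using h0
      simp only [f, id]
      field_simp
      nlinarith
  have hHFFH : H * cfc f H * cfc f H * H = H := by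
    conv_lhs => enter [2]; rw [← cfc_id ℝ H]
    conv_lhs => enter [1, 1, 1]; rw [← cfc_id ℝ H]
    conv_rhs => rw [← cfc_id ℝ H]
    rw [← cfc_mul _ _ H (hc _) (hc _), ← cfc_mul _ _ H (hc _) (hc _),
      ← cfc_mul _ _ H (hc _) (hc _)]
    refine cfc_congr fun t ht ↦ ?_
    rcases eq_or_ne t 0 with rfl | h0
    · simp [f]
    · have h1 := Real.mul_self_sqrt (hspec t ht)
      have h2 : √t ≠ 0 := by simpa [Real.sqrt_eq_zero (hspec t ht)] using h0
      simp only [f, id]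
      field_simp
      nlinarith
  have hcomm (X) (hX : Commute H X) : Commute (cfc f H) X := hX.cfc_real f
  refine ⟨cfc f H, hcomm, fun h ↦ hZ ?_, ?_⟩
  · have : H = 0 := by
      rw [← hHFFH]
      simp only [H, mul_assoc Zᴴ, h, mul_zero, zero_mul]
    exact conjTranspose_mul_self_eq_zero.1 this
  · have hFH : cfc f H * H = H * cfc f H := hcomm _ (Commute.refl H)
    rw [conjTranspose_mul, hFs]
    calc _ = Z * (cfc f H * (cfc f H * H) * cfc f H) := by simp only [H, mul_assoc]
      _ = Z * (cfc f H * H * cfc f H * cfc f H) := by rw [mul_assoc (cfc f H) H, ← hFH]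
      _ = _ := by rw [hFHF]

/-- A star subalgebra of pairs of matrices whose components have equal traces is implemented by
a unitary intertwiner. -/
lemma exists_unitary_intertwiner (S : StarSubalgebra ℂ (Matrix m m ℂ × Matrix m m ℂ))
    (htr : ∀ x ∈ S, x.1.trace = x.2.trace) :
    ∃ W : Matrix m m ℂ, Wᴴ * W = 1 ∧ ∀ x ∈ S, x.2 * W = W * x.1 := by
  let s : Set (Matrix m m ℂ) := {W | W * Wᴴ * W = W ∧ ∀ x ∈ S, x.2 * W = W * x.1}
  have hs : s.Nonempty := ⟨0, by simp [s]⟩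
  obtain ⟨W, hW, hmin⟩ := WellFounded.has_min
    (InvImage.wf (fun W : Matrix m m ℂ ↦ LinearMap.ker (LinearMap.mulLeft ℂ W)) wellFounded_lt) s hs
  obtain ⟨hWW, hWS⟩ := hW
  refine ⟨W, by_contra fun hne ↦ ?_, hWS⟩
  have hWS' : ∀ x ∈ S, Wᴴ * x.2 = x.1 * Wᴴ := fun x hx ↦ by
    have := congrArg conjTranspose (hWS _ (star_mem hx))
    simpa [star_eq_conjTranspose] using this
  have hWW' : Wᴴ * W * Wᴴ = Wᴴ := by
    simpa [mul_assoc] using congrArg conjTranspose hWW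
  set P := 1 - Wᴴ * W
  set Q := 1 - W * Wᴴ
  have hPs : Pᴴ = P := by simp [P]
  have hQs : Qᴴ = Q := by simp [Q]
  have hPP : P * P = P := by
    simp only [P, mul_sub, sub_mul, ← mul_assoc, hWW', one_mul, mul_one]; abel
  have hQQ : Q * Q = Q := by
    simp only [Q, mul_sub, sub_mul, ← mul_assoc, hWW, one_mul, mul_one]; abel
  have hWP : W * P = 0 := by simp [P, mul_sub, ← mul_assoc, hWW]
  have hWQ : Wᴴ * Q = 0 := by simp [Q, mul_sub, ← mul_assoc, hWW']
  have hPS : ∀ x ∈ S, x.1 * P = P * x.1 := fun x hx ↦ by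
    simp only [P, mul_sub, sub_mul, one_mul, mul_one, ← mul_assoc, ← hWS' x hx]
    rw [mul_assoc, hWS x hx, mul_assoc]
  have hQS : ∀ x ∈ S, x.2 * Q = Q * x.2 := fun x hx ↦ by
    simp only [Q, mul_sub, sub_mul, one_mul, mul_one, ← mul_assoc, hWS x hx]
    rw [mul_assoc, ← hWS' x hx, mul_assoc]
  let T : Submodule ℂ (Matrix m m ℂ × Matrix m m ℂ) :=
    S.toSubalgebra.toSubmodule.map (LinearMap.mulLeft ℂ (P, Q))
  have hmem (x) : x ∈ T ↔ ∃ y ∈ S, (P * y.1, Q * y.2) = x := Iff.rfl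
  obtain ⟨Z, hZ, hZP, hQZ, hZT⟩ :
      ∃ Z : Matrix m m ℂ, Z ≠ 0 ∧ Z * P = Z ∧ Q * Z = Z ∧ ∀ x ∈ T, x.2 * Z = Z * x.1 := by
    refine exists_ne_zero_intertwiner T (fun h ↦ hne ?_) ?_ ?_ ?_ ?_ ?_
    · have : (P * (1 : Matrix m m ℂ), Q * (1 : Matrix m m ℂ)) ∈ T := (hmem _).2 ⟨1, one_mem S, rfl⟩
      rw [h, Submodule.mem_bot] at this
      have := congrArg Prod.fst this
      simp only [mul_one, Prod.fst_zero, P, sub_eq_zero] at this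
      exact this.symm
    · rintro _ ⟨x, hx, rfl⟩ _ ⟨y, hy, rfl⟩
      refine (hmem _).2 ⟨x * y, mul_mem hx hy, Prod.ext ?_ ?_⟩
      · change P * (x.1 * y.1) = P * x.1 * (P * y.1)
        rw [mul_assoc P x.1 (P * y.1), ← mul_assoc x.1 P, hPS x hx, mul_assoc P x.1 y.1,
          ← mul_assoc P P, hPP]
      · change Q * (x.2 * y.2) = Q * x.2 * (Q * y.2)
        rw [mul_assoc Q x.2 (Q * y.2), ← mul_assoc x.2 Q, hQS x hx, mul_assoc Q x.2 y.2,
          ← mul_assoc Q Q, hQQ]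
    · rintro _ ⟨x, hx, rfl⟩
      refine (hmem _).2 ⟨star x, star_mem hx, Prod.ext ?_ ?_⟩
      · change P * x.1ᴴ = (P * x.1)ᴴ
        rw [← hPS x hx, conjTranspose_mul, hPs]
      · change Q * x.2ᴴ = (Q * x.2)ᴴ
        rw [← hQS x hx, conjTranspose_mul, hQs]
    · rintro _ ⟨x, hx, rfl⟩
      change (P * x.1).trace = (Q * x.2).trace
      simp only [P, Q, sub_mul, one_mul, trace_sub, htr x hx]
      rw [mul_assoc, ← hWS x hx, trace_mul_comm, trace_mul_comm (W * Wᴴ), mul_assoc]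
    · rintro _ ⟨x, hx, rfl⟩
      change P * x.1 * P = P * x.1
      rw [mul_assoc, hPS x hx, ← mul_assoc, hPP]
    · rintro _ ⟨x, hx, rfl⟩
      change Q * (Q * x.2) = Q * x.2
      rw [← mul_assoc, hQQ]
  have hZS : ∀ x ∈ S, x.2 * Z = Z * x.1 := fun x hx ↦ by
    calc x.2 * Z = Q * x.2 * Z := by rw [← hQS x hx, mul_assoc, hQZ]
      _ = Z * (P * x.1) := hZT _ ((hmem _).2 ⟨x, hx, rfl⟩)
      _ = Z * x.1 := by rw [← mul_assoc, hZP]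
  have hZS' : ∀ x ∈ S, Zᴴ * x.2 = x.1 * Zᴴ := fun x hx ↦ by
    have := congrArg conjTranspose (hZS _ (star_mem hx))
    simpa [star_eq_conjTranspose] using this
  have hPZ : P * Zᴴ = Zᴴ := by simpa [hPs] using congrArg conjTranspose hZP
  obtain ⟨F, hF, hV0, hVV⟩ := exists_partialIsometry_mul hZ
  have hVP : Z * F * P = Z * F := by
    have : F * P = P * F := hF P <| by
      rw [commute_iff_eq, mul_assoc, hZP, ← mul_assoc, hPZ]
    rw [mul_assoc, this, ← mul_assoc, hZP]
  have hVS : ∀ x ∈ S, x.2 * (Z * F) = Z * F * x.1 := fun x hx ↦ by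
    have : F * x.1 = x.1 * F := hF x.1 <| by
      rw [commute_iff_eq, mul_assoc, ← hZS x hx, ← mul_assoc, hZS' x hx, mul_assoc]
    rw [← mul_assoc, hZS x hx, mul_assoc, ← this, mul_assoc]
  have hQV : Q * (Z * F) = Z * F := by rw [← mul_assoc, hQZ]
  set V := Z * F
  have hWV : Wᴴ * V = 0 := by rw [← hQV, ← mul_assoc, hWQ, zero_mul]
  have hVW : Vᴴ * W = 0 := by simpa using congrArg conjTranspose hWV
  have hWVt : W * Vᴴ = 0 := by
    have : W * Vᴴ = W * (V * P)ᴴ := by rw [hVP]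
    rw [this, conjTranspose_mul, hPs, ← mul_assoc, hWP, zero_mul]
  have hVWt : V * Wᴴ = 0 := by simpa using congrArg conjTranspose hWVt
  refine hmin (W + V) ⟨?_, fun x hx ↦ by rw [mul_add, add_mul, hWS x hx, hVS x hx]⟩ ?_
  · simp only [conjTranspose_add, add_mul, mul_add, hWVt, hVWt, hWW, hVV, add_zero,
      zero_add, mul_assoc W, mul_assoc V, hWV, hVW, mul_zero]
  · refine SetLike.lt_iff_le_and_exists.2 ⟨fun M hM ↦ ?_, P, hWP, fun h ↦ hV0 ?_⟩
    · change W * M = 0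
      have hM' : (W + V) * M = 0 := hM
      calc W * M = W * Wᴴ * ((W + V) * M) := by
            rw [← mul_assoc, mul_add, hWW, mul_assoc W, hWV, mul_zero, add_zero]
        _ = 0 := by rw [hM', mul_zero]
    · have h' : (W + V) * P = 0 := h
      rwa [add_mul, hWP, zero_add, hVP] at h'

/-- Equality of the traces of words extends to the generated star subalgebra of pairs. -/
lemma trace_eq_of_mem_adjoin {A B : Matrix m m ℂ}
    (h : ∀ w : List Bool, w ≠ [] →
      ((w.map fun ε => cond ε Aᴴ A).prod).trace = ((w.map fun ε => cond ε Bᴴ B).prod).trace) :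
    ∀ x ∈ StarAlgebra.adjoin ℂ {(A, B)}, x.1.trace = x.2.trace := by
  intro x hx
  have hx' : x ∈ Submodule.span ℂ
      (Submonoid.closure ({(A, B)} ∪ star {(A, B)} : Set (Matrix m m ℂ × Matrix m m ℂ)) : Set _) := by
    rw [← Algebra.adjoin_eq_span]
    exact hx
  clear hx
  induction hx' using Submodule.span_induction with
  | mem x hx =>
    have hw : ∃ w : List Bool, x =
        ((w.map fun ε => cond ε Aᴴ A).prod, (w.map fun ε => cond ε Bᴴ B).prod) := by
      induction hx using Submonoid.closure_induction_left with
      | one => exact ⟨[], rfl⟩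
      | mul_left y hy z _ ih =>
        obtain ⟨w, rfl⟩ := ih
        rcases hy with rfl | hy
        · exact ⟨false :: w, by simp⟩
        · obtain rfl : y = (Aᴴ, Bᴴ) := by
            rw [Set.star_singleton, Set.mem_singleton_iff] at hy
            exact hy
          exact ⟨true :: w, by simp⟩
    obtain ⟨w, rfl⟩ := hw
    rcases eq_or_ne w [] with rfl | hne
    · simp
    · exact h w hne
  | zero => simp
  | add x y _ _ hx hy => simp [hx, hy]
  | smul c x _ hx => simp [hx]

end

/-- **Specht's criterion for unitary similarity.**
Two `n × n` complex matrices `A` and `B` are unitarily similar (`B = U⁻¹ * A * U` for some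
unitary `U`) iff `trace w(A, Aᴴ) = trace w(B, Bᴴ)` for every word `w(x, y)` in two
noncommuting variables.  A word is encoded as a nonempty list of Booleans, where `false`
stands for the letter `x` (evaluated at the matrix itself) and `true` stands for the
letter `y` (evaluated at the conjugate transpose). -/
theorem specht_unitary_similarity (n : ℕ) (A B : Matrix (Fin n) (Fin n) ℂ) :
    (∃ U : Matrix (Fin n) (Fin n) ℂ, Uᴴ * U = 1 ∧ B = U⁻¹ * A * U) ↔
    (∀ w : List Bool, w ≠ [] →
      ((w.map fun ε => cond ε Aᴴ A).prod).trace =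
      ((w.map fun ε => cond ε Bᴴ B).prod).trace) := by
  refine ⟨?_, fun h ↦ ?_⟩
  · rintro ⟨U, hU, rfl⟩ w -
    have hU' : U * Uᴴ = 1 := mul_eq_one_comm.1 hU
    rw [inv_eq_left_inv hU]
    have hw (w : List Bool) : (w.map fun ε => cond ε (Uᴴ * A * U)ᴴ (Uᴴ * A * U)).prod =
        Uᴴ * (w.map fun ε => cond ε Aᴴ A).prod * U := by
      induction w with
      | nil => simp [hU]
      | cons ε w ih =>
        have hε : cond ε (Uᴴ * A * U)ᴴ (Uᴴ * A * U) = Uᴴ * cond ε Aᴴ A * U := by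
          cases ε <;> simp [mul_assoc]
        simp only [List.map_cons, List.prod_cons, ih, hε]
        simp only [mul_assoc]
        rw [← mul_assoc U, hU', one_mul]
    rw [hw, mul_assoc, trace_mul_comm, mul_assoc, hU', mul_one]
  · obtain ⟨W, hW, hWS⟩ := exists_unitary_intertwiner _ (trace_eq_of_mem_adjoin h)
    have hW' : W * Wᴴ = 1 := mul_eq_one_comm.1 hW
    have hBW : B * W = W * A := hWS _ (StarAlgebra.self_mem_adjoin_singleton ℂ (A, B))
    refine ⟨Wᴴ, by simpa using hW', ?_⟩
    rw [inv_eq_left_inv hW', ← hBW, mul_assoc, hW', mul_one]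
end

section
/- Let (A₁,…,A_k) and (B₁,…,B_k) be two k-tuples of n×n complex matrices. There exists a unitary matrix U such that U⁻¹A_iU = B_i for every i = 1,…,k if and only if trace w(A₁, A₁ᴴ, …, A_k, A_kᴴ) = trace w(B₁, B₁ᴴ, …, B_k, B_kᴴ) for every word w(x₁, y₁, …, x_k, y_k) in 2k noncommuting variables; that is, for every nonempty finite sequence (i₁,ε₁),…,(i_ℓ,ε_ℓ) with each i_j ∈ {1,…,k} and each ε_j ∈ {1,*}, trace(A_{i₁}^{(ε₁)}···A_{i_ℓ}^{(ε_ℓ)}) = trace(B_{i₁}^{(ε₁)}···B_{i_ℓ}^{(ε_ℓ)}), where M^{(1)} = M and M^{(*)} = Mᴴ. -/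
open Matrix

section Trace

variable {K R : Type*} [Field K] [Ring R] [Algebra K R]

instance IsSemisimpleModule.prod {V W : Type*} [AddCommGroup V] [Module R V] [AddCommGroup W]
    [Module R W] [IsSemisimpleModule R V] [IsSemisimpleModule R W] :
    IsSemisimpleModule R (V × W) := by
  have : IsSemisimpleModule R (⊤ : Submodule R (V × W)) := by
    rw [← LinearMap.sup_range_inl_inr]
    exact IsSemisimpleModule.sup (.range _) (.range _)
  exact .congr Submodule.topEquiv.symm

theorem IsSemisimpleModule.exists_ne_zero_of_trace_eq [CharZero K] {V W : Type*}
    [AddCommGroup V] [Module K V] [Module R V] [IsScalarTower K R V] [FiniteDimensional K V]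
    [AddCommGroup W] [Module K W] [Module R W] [IsScalarTower K R W] [FiniteDimensional K W]
    [IsSemisimpleModule R V] [IsSemisimpleModule R W] [Nontrivial V]
    (h : ∀ r : R, LinearMap.trace K V (Algebra.lsmul K K V r) =
      LinearMap.trace K W (Algebra.lsmul K K W r)) :
    ∃ f : V →ₗ[R] W, f ≠ 0 := by
  classical
  by_contra! hVW
  have hWV (g : W →ₗ[R] V) : g = 0 := by
    obtain ⟨s, hs⟩ := IsSemisimpleModule.lifting_property g.rangeRestrict
      g.surjective_rangeRestrict LinearMap.id
    obtain ⟨t, ht⟩ := IsSemisimpleModule.extension_property (LinearMap.range g).subtype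
      (LinearMap.range g).injective_subtype s
    rw [hVW t, LinearMap.zero_comp] at ht
    ext w
    have := congr(($hs (g.rangeRestrict w) : V))
    simpa [← ht] using this.symm
  let p : Module.End (Module.End R (V × W)) (V × W) :=
    { toFun x := (x.1, 0)
      map_add' x y := by simp
      map_smul' φ x := by
        have h₁ := congr($(hVW (LinearMap.snd R V W ∘ₗ φ ∘ₗ LinearMap.inl R V W)) x.1)
        have h₂ := congr($(hWV (LinearMap.fst R V W ∘ₗ φ ∘ₗ LinearMap.inr R V W)) x.2)
        have h₃ : φ x = φ (x.1, 0) + φ (0, x.2) := by rw [← map_add]; simp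
        simp only [LinearMap.comp_apply, LinearMap.inl_apply, LinearMap.inr_apply,
          LinearMap.fst_apply, LinearMap.snd_apply, LinearMap.zero_apply] at h₁ h₂
        ext <;> simp [h₁, h₂, h₃] }
  let b := Module.finBasis K (V × W)
  obtain ⟨r, hr⟩ := jacobson_density p (Finset.univ.image b)
  have key : LinearMap.inl K V W ∘ₗ LinearMap.fst K V W = Algebra.lsmul K K (V × W) r :=
    b.ext fun i => hr (b i) (by simp)
  have hV : Algebra.lsmul K K V r = 1 := by
    ext v
    simpa using congr(($key (v, 0)).1).symm
  have hW : Algebra.lsmul K K W r = 0 := by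
    ext w
    simpa using congr(($key (0, w)).2).symm
  have := h r
  rw [hV, hW, LinearMap.trace_one, map_zero, Nat.cast_eq_zero] at this
  exact Module.finrank_pos.ne' this

theorem LinearMap.trace_lsmul_prod {V W : Type*}
    [AddCommGroup V] [Module K V] [Module R V] [IsScalarTower K R V] [FiniteDimensional K V]
    [AddCommGroup W] [Module K W] [Module R W] [IsScalarTower K R W] [FiniteDimensional K W]
    (r : R) :
    LinearMap.trace K (V × W) (Algebra.lsmul K K (V × W) r) =
      LinearMap.trace K V (Algebra.lsmul K K V r) +
        LinearMap.trace K W (Algebra.lsmul K K W r) := by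
  rw [← LinearMap.trace_prodMap']
  rfl

theorem LinearEquiv.trace_lsmul_eq {V W : Type*}
    [AddCommGroup V] [Module K V] [Module R V] [IsScalarTower K R V]
    [AddCommGroup W] [Module K W] [Module R W] [IsScalarTower K R W]
    (e : V ≃ₗ[R] W) (r : R) :
    LinearMap.trace K V (Algebra.lsmul K K V r) = LinearMap.trace K W (Algebra.lsmul K K W r) := by
  rw [← LinearMap.trace_conj' _ (e.restrictScalars K)]
  congr 1
  ext w
  simp [LinearEquiv.conj_apply]

/-- Finite-dimensional semisimple modules over an algebra over a field of characteristic zero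
are determined up to isomorphism by their characters. -/
theorem IsSemisimpleModule.nonempty_linearEquiv_of_trace_eq [CharZero K] {V W : Type*}
    [AddCommGroup V] [Module K V] [Module R V] [IsScalarTower K R V] [FiniteDimensional K V]
    [AddCommGroup W] [Module K W] [Module R W] [IsScalarTower K R W] [FiniteDimensional K W]
    [IsSemisimpleModule R V] [IsSemisimpleModule R W]
    (h : ∀ r : R, LinearMap.trace K V (Algebra.lsmul K K V r) =
      LinearMap.trace K W (Algebra.lsmul K K W r)) :
    Nonempty (V ≃ₗ[R] W) := by
  induction hd : Module.finrank K V using Nat.strong_induction_on generalizing V W with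
  | _ d ih =>
    have hfin : Module.finrank K V = Module.finrank K W := by
      simpa [LinearMap.trace_one] using h 1
    rcases subsingleton_or_nontrivial V with hV | hV
    · have : Subsingleton W := by
        rw [← Module.finrank_zero_iff (R := K), ← hfin, Module.finrank_zero_of_subsingleton]
      exact ⟨0⟩
    obtain ⟨f, hf⟩ := exists_ne_zero_of_trace_eq h
    obtain ⟨C, hC⟩ := exists_isCompl (LinearMap.range f)
    obtain ⟨D, hD⟩ := exists_isCompl (LinearMap.ker f)
    let eV : V ≃ₗ[R] LinearMap.ker f × LinearMap.range f :=
      (Submodule.prodEquivOfIsCompl _ _ hD).symm ≪≫ₗ (LinearEquiv.refl R _).prodCongr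
        ((Submodule.quotientEquivOfIsCompl _ _ hD).symm ≪≫ₗ f.quotKerEquivRange)
    let eW : W ≃ₗ[R] C × LinearMap.range f :=
      (Submodule.prodEquivOfIsCompl _ _ hC.symm).symm
    have : FiniteDimensional K (LinearMap.ker f) :=
      inferInstanceAs (FiniteDimensional K ((LinearMap.ker f).restrictScalars K))
    have : FiniteDimensional K (LinearMap.range f) :=
      inferInstanceAs (FiniteDimensional K ((LinearMap.range f).restrictScalars K))
    have : FiniteDimensional K C :=
      inferInstanceAs (FiniteDimensional K (C.restrictScalars K))
    have hlt : Module.finrank K (LinearMap.ker f) < d := by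
      rw [← hd]
      refine Submodule.finrank_lt (s := (LinearMap.ker f).restrictScalars K) ?_
      simpa [LinearMap.ker_eq_top, Submodule.restrictScalars_eq_top_iff] using hf
    obtain ⟨e⟩ := ih _ hlt (V := LinearMap.ker f) (W := C) (fun r => by
      have := h r
      rwa [eV.trace_lsmul_eq, eW.trace_lsmul_eq, LinearMap.trace_lsmul_prod,
        LinearMap.trace_lsmul_prod, add_left_inj] at this) rfl
    exact ⟨eV ≪≫ₗ e.prodCongr (.refl R _) ≪≫ₗ eW.symm⟩

end Trace

section Polar

/-- Two self-adjoint families that are similar via a unit of a C⋆-algebra are similar via a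
unitary, namely the unitary part of the unit. -/
theorem CStarAlgebra.exists_unitary_conj_of_isUnit {𝒜 ι : Type*} [CStarAlgebra 𝒜]
    [PartialOrder 𝒜] [StarOrderedRing 𝒜] {a b : ι → 𝒜} {s : 𝒜} (hs : IsUnit s)
    (h : ∀ i, s * a i = b i * s) (h' : ∀ i, s * star (a i) = star (b i) * s) :
    ∃ u ∈ unitary 𝒜, ∀ i, u * a i = b i * u := by
  have hcomm (i : ι) : Commute (star s * s) (a i) := by
    have := congr(star $(h' i))
    simp only [star_mul, star_star] at this
    rw [commute_iff_eq, mul_assoc, h, ← mul_assoc, ← mul_assoc, this]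
  have hp : IsUnit (CFC.abs s) := by
    rw [CFC.abs, CFC.isUnit_sqrt_iff _ (star_mul_self_nonneg s)]
    exact hs.star.mul hs
  obtain ⟨p, hp⟩ := hp
  obtain ⟨s, rfl⟩ := hs
  have hpc (i : ι) : Commute (p : 𝒜) (a i) := hp ▸ Commute.cfcₙ_nnreal (hcomm i) _
  have hpstar : star (p : 𝒜) = p := by rw [hp]; exact (CFC.abs_nonneg _).star_eq
  have hpp : (p : 𝒜) * p = star (s : 𝒜) * s := by rw [hp, CFC.abs_mul_abs]
  have hpstar' : star p = p := Units.ext hpstar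
  have hpp' : p * p = star s * s := Units.ext hpp
  have hu : star (s * p⁻¹) * (s * p⁻¹) = 1 := by
    rw [star_mul, star_inv, hpstar', mul_assoc, ← mul_assoc (star s), ← hpp']
    group
  refine ⟨(s * p⁻¹ : 𝒜ˣ), ?_, fun i => ?_⟩
  · have hu' : (s * p⁻¹) * star (s * p⁻¹) = 1 := by
      rw [eq_inv_of_mul_eq_one_left hu, mul_inv_cancel]
    exact ⟨congr(($hu : 𝒜)), congr(($hu' : 𝒜))⟩
  · rw [Units.val_mul, mul_assoc, ((hpc i).units_inv_left).eq, ← mul_assoc, h, mul_assoc]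

end Polar

section Representation

/-- The space on which `ρ` acts, as a module over the source of `ρ`. -/
def AlgHom.RepSpace {K R V : Type*} [CommSemiring K] [Semiring R] [Algebra K R] [AddCommGroup V]
    [Module K V] (_ρ : R →ₐ[K] Module.End K V) : Type _ := V

namespace AlgHom.RepSpace

section

variable {K R V : Type*} [CommSemiring K] [Semiring R] [Algebra K R] [AddCommGroup V] [Module K V]
  (ρ : R →ₐ[K] Module.End K V)

instance : AddCommGroup ρ.RepSpace := inferInstanceAs (AddCommGroup V)

instance : Module K ρ.RepSpace := inferInstanceAs (Module K V)

instance [Module.Finite K V] : Module.Finite K ρ.RepSpace := inferInstanceAs (Module.Finite K V)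

instance : Module R ρ.RepSpace := Module.compHom V ρ.toRingHom

theorem smul_def (r : R) (v : ρ.RepSpace) : r • v = ρ r v := rfl

instance : IsScalarTower K R ρ.RepSpace where
  smul_assoc c r v := by
    rw [smul_def, smul_def, map_smul]
    rfl

end

/-- Two finite-dimensional semisimple representations in characteristic zero with the same
character are intertwined by a linear equivalence. -/
theorem exists_linearEquiv_of_trace_eq {K R V : Type*} [Field K] [CharZero K] [Ring R]
    [Algebra K R] [AddCommGroup V] [Module K V] [FiniteDimensional K V]
    {ρ σ : R →ₐ[K] Module.End K V} (hρ : IsSemisimpleModule R ρ.RepSpace)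
    (hσ : IsSemisimpleModule R σ.RepSpace)
    (h : ∀ r, LinearMap.trace K V (ρ r) = LinearMap.trace K V (σ r)) :
    ∃ e : V ≃ₗ[K] V, ∀ r v, e (ρ r v) = σ r (e v) := by
  have key (r : R) : LinearMap.trace K ρ.RepSpace (Algebra.lsmul K K ρ.RepSpace r) =
      LinearMap.trace K σ.RepSpace (Algebra.lsmul K K σ.RepSpace r) := h r
  obtain ⟨e⟩ := IsSemisimpleModule.nonempty_linearEquiv_of_trace_eq key
  exact ⟨e.restrictScalars K, e.map_smul⟩

theorem isSemisimpleModule {𝕜 R E : Type*} [RCLike 𝕜] [Ring R] [Algebra 𝕜 R]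
    [NormedAddCommGroup E] [InnerProductSpace 𝕜 E] [FiniteDimensional 𝕜 E]
    (ρ : R →ₐ[𝕜] Module.End 𝕜 E)
    (hρ : ∀ r, ∃ s, ∀ v w : E, inner 𝕜 (ρ s v) w = inner 𝕜 v (ρ r w)) :
    IsSemisimpleModule R ρ.RepSpace where
  exists_isCompl p := by
    let p' : Submodule 𝕜 E := p.restrictScalars 𝕜
    let q : Submodule R ρ.RepSpace :=
      { p'ᗮ with
        smul_mem' r v hv := by
          obtain ⟨s, hs⟩ := hρ r
          exact fun w hw => (hs w v).symm.trans (hv (ρ s w) (p.smul_mem s hw)) }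
    have h := Submodule.isCompl_orthogonal (K := p')
    refine ⟨q, ?_, ?_⟩
    · exact Submodule.disjoint_def.2 fun x => Submodule.disjoint_def.1 h.disjoint x
    · refine Submodule.codisjoint_iff_exists_add_eq.2 fun x => ?_
      exact Submodule.codisjoint_iff_exists_add_eq.1 h.codisjoint x

end AlgHom.RepSpace

/-- Two finite-dimensional `⋆`-closed representations with the same character are intertwined by
an invertible operator. -/
theorem AlgHom.exists_isUnit_intertwining_of_trace_eq {R E : Type*} [Ring R] [Algebra ℂ R]
    [NormedAddCommGroup E] [InnerProductSpace ℂ E] [FiniteDimensional ℂ E] [CompleteSpace E]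
    {ρ σ : R →ₐ[ℂ] (E →L[ℂ] E)} (hρ : ∀ r, ∃ s, ρ s = star (ρ r))
    (hσ : ∀ r, ∃ s, σ s = star (σ r))
    (h : ∀ r, LinearMap.trace ℂ E (ρ r).toLinearMap = LinearMap.trace ℂ E (σ r).toLinearMap) :
    ∃ t : E →L[ℂ] E, IsUnit t ∧ ∀ r, t * ρ r = σ r * t := by
  let linearize (τ : R →ₐ[ℂ] (E →L[ℂ] E)) : R →ₐ[ℂ] Module.End ℂ E :=
    { ContinuousLinearMap.toLinearMapRingHom.comp τ.toRingHom with
      commutes' c := by ext v; exact congr($(τ.commutes c) v) }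
  have hss (τ : R →ₐ[ℂ] (E →L[ℂ] E)) (hτ : ∀ r, ∃ s, τ s = star (τ r)) :
      IsSemisimpleModule R (linearize τ).RepSpace := by
    refine RepSpace.isSemisimpleModule _ fun r => ?_
    obtain ⟨s, hs⟩ := hτ r
    refine ⟨s, fun v w => ?_⟩
    change inner ℂ (τ s v) w = inner ℂ v (τ r w)
    rw [hs, ContinuousLinearMap.star_eq_adjoint, ContinuousLinearMap.adjoint_inner_left]
  obtain ⟨e, he⟩ := RepSpace.exists_linearEquiv_of_trace_eq (hss ρ hρ) (hss σ hσ) h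
  refine ⟨e.toContinuousLinearEquiv, ⟨e.toContinuousLinearEquiv.toUnit, rfl⟩, fun r => ?_⟩
  ext v
  exact he r v

end Representation

section Words

variable {ι E : Type*} [NormedAddCommGroup E] [InnerProductSpace ℂ E] [CompleteSpace E]

/-- The evaluation of noncommutative polynomials in letters `(i, ε)` at the operators `a i`
(for `ε = false`) and their adjoints (for `ε = true`). -/
noncomputable def starEval (a : ι → E →L[ℂ] E) :
    MonoidAlgebra ℂ (FreeMonoid (ι × Bool)) →ₐ[ℂ] (E →L[ℂ] E) :=
  MonoidAlgebra.lift ℂ _ _ (FreeMonoid.lift fun p => cond p.2 (star (a p.1)) (a p.1))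

theorem starEval_of (a : ι → E →L[ℂ] E) (w : FreeMonoid (ι × Bool)) :
    starEval a (MonoidAlgebra.of ℂ _ w) =
      (w.toList.map fun p => cond p.2 (star (a p.1)) (a p.1)).prod := by
  simp [starEval, FreeMonoid.lift_apply]

theorem exists_starEval_eq_star (a : ι → E →L[ℂ] E) (r : MonoidAlgebra ℂ (FreeMonoid (ι × Bool))) :
    ∃ s, starEval a s = star (starEval a r) := by
  induction r using MonoidAlgebra.induction_on with
  | of w =>
    induction w using FreeMonoid.inductionOn' with
    | one => exact ⟨1, by rw [map_one, map_one, map_one, star_one]⟩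
    | of_mul p w ih =>
      obtain ⟨s, hs⟩ := ih
      refine ⟨s * MonoidAlgebra.of ℂ _ (FreeMonoid.of (p.1, !p.2)), ?_⟩
      rw [map_mul, map_mul, map_mul, star_mul, hs,
        starEval_of a (.of _), starEval_of a (.of p)]
      rcases p with ⟨i, _ | _⟩ <;> simp
  | add x y hx hy =>
    obtain ⟨s, hs⟩ := hx
    obtain ⟨t, ht⟩ := hy
    exact ⟨s + t, by simp [hs, ht]⟩
  | smul c x hx =>
    obtain ⟨s, hs⟩ := hx
    exact ⟨star c • s, by simp [hs]⟩

theorem trace_starEval_eq {a b : ι → E →L[ℂ] E}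
    (h : ∀ w : List (ι × Bool), w ≠ [] →
      LinearMap.trace ℂ E
        (w.map fun p => cond p.2 (star (a p.1)) (a p.1)).prod.toLinearMap =
      LinearMap.trace ℂ E
        (w.map fun p => cond p.2 (star (b p.1)) (b p.1)).prod.toLinearMap)
    (r : MonoidAlgebra ℂ (FreeMonoid (ι × Bool))) :
    LinearMap.trace ℂ E (starEval a r).toLinearMap =
      LinearMap.trace ℂ E (starEval b r).toLinearMap := by
  induction r using MonoidAlgebra.induction_on with
  | of w =>
    rw [starEval_of, starEval_of]
    by_cases hw : w.toList = []
    · rw [hw]; rfl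
    · exact h _ hw
  | add x y hx hy => simp [hx, hy]
  | smul c x hx => simp [hx]

/-- Operators on a finite-dimensional Hilbert space are simultaneously unitarily similar as soon
as the traces of all nonempty words in the operators and their adjoints agree. -/
theorem exists_unitary_conj_of_trace_eq [FiniteDimensional ℂ E] {a b : ι → E →L[ℂ] E}
    (h : ∀ w : List (ι × Bool), w ≠ [] →
      LinearMap.trace ℂ E
        (w.map fun p => cond p.2 (star (a p.1)) (a p.1)).prod.toLinearMap =
      LinearMap.trace ℂ E
        (w.map fun p => cond p.2 (star (b p.1)) (b p.1)).prod.toLinearMap) :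
    ∃ u ∈ unitary (E →L[ℂ] E), ∀ i, u * a i = b i * u := by
  obtain ⟨t, ht, h⟩ := AlgHom.exists_isUnit_intertwining_of_trace_eq
    (exists_starEval_eq_star a) (exists_starEval_eq_star b) (trace_starEval_eq h)
  refine CStarAlgebra.exists_unitary_conj_of_isUnit ht (fun i => ?_) fun i => ?_
  · simpa only [starEval_of, FreeMonoid.toList_of, List.map_singleton, List.prod_singleton,
      cond_false] using h (.of ℂ _ (.of (i, false)))
  · simpa only [starEval_of, FreeMonoid.toList_of, List.map_singleton, List.prod_singleton,
      cond_true] using h (.of ℂ _ (.of (i, true)))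

end Words

theorem Matrix.trace_toEuclideanCLM {m : Type*} [Fintype m] [DecidableEq m] (M : Matrix m m ℂ) :
    LinearMap.trace ℂ _ (toEuclideanCLM (𝕜 := ℂ) M).toLinearMap = M.trace := by
  rw [coe_toEuclideanCLM_eq_toEuclideanLin, toEuclideanLin_eq_toLin_orthonormal,
    trace_toLin_eq]

/-- Words in `M i` and their conjugate transposes are carried to words in the associated operators
and their adjoints. -/
theorem Matrix.toEuclideanCLM_word {m ι : Type*} [Fintype m] [DecidableEq m]
    (M : ι → Matrix m m ℂ) (w : List (ι × Bool)) :
    toEuclideanCLM (𝕜 := ℂ) (w.map fun p => cond p.2 (M p.1)ᴴ (M p.1)).prod =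
      (w.map fun p => cond p.2 (star (toEuclideanCLM (𝕜 := ℂ) (M p.1)))
        (toEuclideanCLM (𝕜 := ℂ) (M p.1))).prod := by
  rw [map_list_prod, List.map_map]
  congr 2
  ext1 ⟨i, _ | _⟩
  · rfl
  · exact map_star _ _

theorem Matrix.conj_word {m ι : Type*} [Fintype m] [DecidableEq m] {A B : ι → Matrix m m ℂ}
    {U : Matrix m m ℂ} (hU : Uᴴ * U = 1) (h : ∀ i, U⁻¹ * A i * U = B i) (w : List (ι × Bool)) :
    (w.map fun p => cond p.2 (B p.1)ᴴ (B p.1)).prod =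
      U⁻¹ * (w.map fun p => cond p.2 (A p.1)ᴴ (A p.1)).prod * U := by
  have hinv : U⁻¹ = Uᴴ := inv_eq_left_inv hU
  have hU' : U * Uᴴ = 1 := mul_eq_one_comm.1 hU
  rw [hinv] at h ⊢
  induction w with
  | nil => simp [hU]
  | cons p w ih =>
    have hp : cond p.2 (B p.1)ᴴ (B p.1) = Uᴴ * cond p.2 (A p.1)ᴴ (A p.1) * U := by
      rcases p with ⟨i, _ | _⟩ <;> simp [← h, Matrix.mul_assoc]
    rw [List.map_cons, List.prod_cons, List.map_cons, List.prod_cons, ih, hp]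
    simp only [Matrix.mul_assoc]
    rw [← Matrix.mul_assoc U Uᴴ, hU', Matrix.one_mul]

/-- **Wiegmann's criterion for simultaneous unitary similarity.**
Two `k`-tuples `(A₁, …, A_k)` and `(B₁, …, B_k)` of `n × n` complex matrices are
simultaneously unitarily similar iff the traces of all words in
`A₁, A₁ᴴ, …, A_k, A_kᴴ` and `B₁, B₁ᴴ, …, B_k, B_kᴴ` coincide.  A word is encoded as a
nonempty list of pairs `(i, ε)` with `i : Fin k` and `ε : Bool`, where `ε = false` stands
for the matrix itself and `ε = true` for its conjugate transpose. -/
theorem wiegmann_simultaneous_unitary_similarity (n k : ℕ)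
    (A B : Fin k → Matrix (Fin n) (Fin n) ℂ) :
    (∃ U : Matrix (Fin n) (Fin n) ℂ, Uᴴ * U = 1 ∧ ∀ i : Fin k, U⁻¹ * A i * U = B i) ↔
    (∀ w : List (Fin k × Bool), w ≠ [] →
      ((w.map fun p => cond p.2 (A p.1)ᴴ (A p.1)).prod).trace =
      ((w.map fun p => cond p.2 (B p.1)ᴴ (B p.1)).prod).trace) := by
  constructor
  · rintro ⟨U, hU, h⟩ w -
    rw [conj_word hU h w, trace_mul_cycle, mul_nonsing_inv _ (isUnit_det_of_left_inverse hU),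
      Matrix.one_mul]
  · intro h
    obtain ⟨u, hu, hc⟩ := exists_unitary_conj_of_trace_eq
      (a := fun i => toEuclideanCLM (𝕜 := ℂ) (B i)) (b := fun i => toEuclideanCLM (𝕜 := ℂ) (A i))
      (fun w hw => by
        rw [← toEuclideanCLM_word, ← toEuclideanCLM_word, trace_toEuclideanCLM,
          trace_toEuclideanCLM, h w hw])
    obtain ⟨U, rfl⟩ := EquivLike.surjective (toEuclideanCLM (𝕜 := ℂ) (n := Fin n)) u
    have hU : Uᴴ * U = 1 := by
      apply EquivLike.injective (toEuclideanCLM (𝕜 := ℂ) (n := Fin n))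
      rw [map_mul, map_one, ← star_eq_conjTranspose, map_star]
      exact hu.1
    refine ⟨U, hU, fun i => ?_⟩
    have hi : U * B i = A i * U := by
      apply EquivLike.injective (toEuclideanCLM (𝕜 := ℂ) (n := Fin n))
      rw [map_mul, map_mul, hc]
    rw [Matrix.mul_assoc, ← hi, ← Matrix.mul_assoc,
      nonsing_inv_mul _ (isUnit_det_of_left_inverse hU), Matrix.one_mul]
end

section
/- Two n×n real matrices A and B are real orthogonally similar (i.e., B = S⁻¹AS for some real matrix S with SᵀS = I) if and only if trace w(A, Aᵀ) = trace w(B, Bᵀ) for every word w(x,y) in two noncommuting variables; that is, if and only if for every nonempty finite list ε₁,…,ε_ℓ of symbols from {1,T}, trace(A^{(ε₁)}···A^{(ε_ℓ)}) = trace(B^{(ε₁)}···B^{(ε_ℓ)}), where M^{(1)} = M and M^{(T)} = Mᵀ. -/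
open Matrix

section

variable {n : Type*} [Fintype n] [DecidableEq n]

/-- Inverse square root on the support of a positive semidefinite matrix. -/
theorem Matrix.PosSemidef.exists_partial_inv_sqrt {H : Matrix n n ℝ} (hH : H.PosSemidef) :
    ∃ G : Matrix n n ℝ, Gᵀ = G ∧ (∀ X, Commute H X → Commute G X) ∧
      G * G * H * G = G ∧ H * G * G * H = H := by
  have hsa : IsSelfAdjoint H := hH.1
  have hc : ∀ f : ℝ → ℝ, ContinuousOn f (spectrum ℝ H) := fun f =>
    (Matrix.finite_real_spectrum (A := H)).continuousOn f
  have hnn : ∀ x ∈ spectrum ℝ H, 0 ≤ x :=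
    (Matrix.posSemidef_iff_isHermitian_and_spectrum_nonneg.1 hH).2
  set g : ℝ → ℝ := fun x => (√x)⁻¹
  have hid : cfc (fun x : ℝ => x) H = H := cfc_id' ℝ H
  refine ⟨cfc g H, ?_, fun X hX => hX.cfc_real g, ?_, ?_⟩
  · simpa [IsSelfAdjoint, star_eq_conjTranspose] using (cfc_predicate g H : IsSelfAdjoint _)
  · conv_lhs => rw [← hid]
    rw [hid, ← cfc_mul g g H (hc _) (hc _)]
    nth_rw 2 [← hid]
    rw [← cfc_mul _ _ H (hc _) (hc _), ← cfc_mul _ _ H (hc _) (hc _)]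
    refine cfc_congr fun x hx => ?_
    rcases (hnn x hx).eq_or_lt with rfl | h
    · simp [g]
    · have := Real.sqrt_pos.2 h
      have h2 := Real.mul_self_sqrt h.le
      simp only [g]
      field_simp
      nlinarith
  · conv_lhs =>
      rw [mul_assoc H, ← cfc_mul g g H (hc _) (hc _)]
      enter [1, 1]
      rw [← hid]
    rw [← cfc_mul _ _ H (hc _) (hc _)]
    nth_rw 2 [← hid]
    rw [← cfc_mul _ _ H (hc _) (hc _)]
    conv_rhs => rw [← hid]
    refine cfc_congr fun x hx => ?_
    rcases (hnn x hx).eq_or_lt with rfl | h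
    · simp
    · have := Real.sqrt_pos.2 h
      have h2 := Real.mul_self_sqrt h.le
      simp only [g]
      field_simp
      nlinarith

/-- Every space of matrices is expanded by a finite family via the trace form. -/
theorem exists_frobenius_orthonormal_expansion (K : Submodule ℝ (Matrix n n ℝ)) :
    ∃ (k : ℕ) (e : Fin k → Matrix n n ℝ), (∀ i, e i ∈ K) ∧
      ∀ x ∈ K, x = ∑ i, ((e i)ᵀ * x).trace • e i := by
  let _ := Matrix.toMatrixNormedAddCommGroup (1 : Matrix n n ℝ) PosDef.one
  let _ := Matrix.toMatrixInnerProductSpace (1 : Matrix n n ℝ) PosSemidef.one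
  let b := stdOrthonormalBasis ℝ K
  refine ⟨_, fun i => (b i : Matrix n n ℝ), fun i => (b i).2, fun x hx => ?_⟩
  have h := congrArg (K.subtype) (b.sum_repr' ⟨x, hx⟩)
  simp only [map_sum, map_smul, Submodule.subtype_apply] at h
  refine h.symm.trans (Finset.sum_congr rfl fun i _ => ?_)
  congr 1
  change (x * 1 * (b i : Matrix n n ℝ)ᴴ).trace = _
  rw [mul_one, trace_mul_comm, conjTranspose_eq_transpose_of_trivial]

/-- A space of pairs on which both trace forms agree is expanded by a family of pairs orthonormal
in the first coordinate. -/
theorem exists_dual_family_of_trace_eq (D : Submodule ℝ (Matrix n n ℝ × Matrix n n ℝ))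
    (hD : ∀ d ∈ D, (d.1ᵀ * d.1).trace = (d.2ᵀ * d.2).trace) :
    ∃ (k : ℕ) (d : Fin k → Matrix n n ℝ × Matrix n n ℝ), (∀ i, d i ∈ D) ∧
      ∀ x ∈ D, x = ∑ i, ((d i).1ᵀ * x.1).trace • d i := by
  obtain ⟨k, e, he, hx⟩ :=
    exists_frobenius_orthonormal_expansion (D.map (LinearMap.fst ℝ _ _))
  choose d hdD hde using he
  refine ⟨k, d, hdD, fun x hxD => ?_⟩
  have h1 := hx x.1 ⟨x, hxD, rfl⟩
  simp only [← hde, LinearMap.fst_apply] at h1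
  rw [← sub_eq_zero]
  set s := ∑ i, ((d i).1ᵀ * x.1).trace • d i with hs
  have hmem : x - s ∈ D := D.sub_mem hxD (D.sum_mem fun i _ => D.smul_mem _ (hdD i))
  have hfst : (x - s).1 = 0 := by
    rw [Prod.fst_sub, hs, Prod.fst_sum]
    simpa [sub_eq_zero] using h1
  have h2 := hD _ hmem
  rw [hfst] at h2
  refine Prod.ext hfst ?_
  rw [← conjTranspose_eq_transpose_of_trivial (x - s).2] at h2
  exact trace_conjTranspose_mul_self_eq_zero_iff.1 (by simpa using h2.symm)


/-- Averaging over a dual family of an algebra of pairs gives an intertwiner. -/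
theorem dual_family_average_intertwines {D : Submodule ℝ (Matrix n n ℝ × Matrix n n ℝ)}
    {k : ℕ} {d : Fin k → Matrix n n ℝ × Matrix n n ℝ} (hd : ∀ i, d i ∈ D)
    (hx : ∀ x ∈ D, x = ∑ i, ((d i).1ᵀ * x.1).trace • d i) {a b : Matrix n n ℝ}
    (hab : ∀ x ∈ D, (a * x.1, b * x.2) ∈ D) (hab' : ∀ x ∈ D, (aᵀ * x.1, bᵀ * x.2) ∈ D)
    (C : Matrix n n ℝ) :
    (∑ i, (d i).2 * C * (d i).1ᵀ) * a = b * ∑ i, (d i).2 * C * (d i).1ᵀ := by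
  have h1 (i : Fin k) : b * (d i).2 = ∑ j, ((d j).1ᵀ * (a * (d i).1)).trace • (d j).2 := by
    simpa [Prod.snd_sum] using congrArg Prod.snd (hx _ (hab _ (hd i)))
  have h2 (j : Fin k) :
      (d j).1ᵀ * a = ∑ i, ((d j).1ᵀ * (a * (d i).1)).trace • (d i).1ᵀ := by
    have h := congrArg (fun x => (Prod.fst x)ᵀ) (hx _ (hab' _ (hd j)))
    simp only [Prod.fst_sum, Prod.smul_fst, transpose_mul, transpose_transpose, transpose_sum,
      transpose_smul] at h
    rw [h]
    refine Finset.sum_congr rfl fun i _ => ?_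
    rw [← trace_transpose]
    simp [mul_assoc]
  simp only [Finset.sum_mul, Finset.mul_sum, ← mul_assoc, h1]
  rw [Finset.sum_comm]
  refine Finset.sum_congr rfl fun j _ => ?_
  conv_lhs => rw [mul_assoc, h2, Finset.mul_sum]
  exact Finset.sum_congr rfl fun i _ => by simp [mul_assoc]

/-- A trace-preserving correspondence between two corners admits a nonzero intertwiner. -/
theorem exists_ne_zero_intertwiner_s3 {D : Submodule ℝ (Matrix n n ℝ × Matrix n n ℝ)}
    (hD : ∀ d ∈ D, (d.1ᵀ * d.1).trace = (d.2ᵀ * d.2).trace) {P Q : Matrix n n ℝ}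
    (hPQ : (P, Q) ∈ D) (hQ0 : Q ≠ 0) (hP : Pᵀ = P)
    (hPD : ∀ x ∈ D, P * x.1 = x.1) (hQD : ∀ x ∈ D, Q * x.2 = x.2) :
    ∃ T : Matrix n n ℝ, T ≠ 0 ∧ Q * T = T ∧ T * P = T ∧ ∀ a b : Matrix n n ℝ,
      (∀ x ∈ D, (a * x.1, b * x.2) ∈ D) → (∀ x ∈ D, (aᵀ * x.1, bᵀ * x.2) ∈ D) →
        T * a = b * T := by
  obtain ⟨k, d, hd, hx⟩ := exists_dual_family_of_trace_eq D hD
  obtain ⟨C, hC⟩ : ∃ C : Matrix n n ℝ, ∑ i, (d i).2 * C * (d i).1ᵀ ≠ 0 := by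
    by_contra! h
    apply hQ0
    ext p l
    have h1 := congrFun (congrFun (congrArg Prod.snd (hx _ hPQ)) p) l
    simp only [Prod.snd_sum, Prod.smul_snd, Matrix.sum_apply, Matrix.smul_apply, smul_eq_mul,
      trace, diag_apply, mul_apply, transpose_apply] at h1
    rw [h1]
    have h2 (q s : n) : ∑ i, (d i).2 p l * (d i).1 q s = 0 := by
      simpa [Matrix.sum_apply, mul_apply, single_apply, ite_and] using
        congrFun (congrFun (h (Matrix.single l s 1)) p) q
    simp only [Finset.sum_mul]
    rw [Finset.sum_comm]
    refine Finset.sum_eq_zero fun s _ => ?_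
    rw [Finset.sum_comm]
    refine Finset.sum_eq_zero fun q _ => ?_
    calc _ = P q s * ∑ i, (d i).2 p l * (d i).1 q s := by
          rw [Finset.mul_sum]
          exact Finset.sum_congr rfl fun i _ => by ring
      _ = 0 := by rw [h2, mul_zero]
  refine ⟨_, hC, ?_, ?_, fun a b h h' => dual_family_average_intertwines hd hx h h' C⟩
  · simp only [Finset.mul_sum, ← mul_assoc, hQD _ (hd _)]
  · rw [Finset.sum_mul]
    refine Finset.sum_congr rfl fun i _ => ?_
    nth_rw 1 [mul_assoc, ← hP, ← transpose_mul, hPD _ (hd i)]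

/-- The value at `(A, Aᵀ)` of the word encoded by a list of Booleans. -/
def transposeWord (A : Matrix n n ℝ) (w : List Bool) : Matrix n n ℝ :=
  (w.map fun ε => cond ε Aᵀ A).prod

theorem transposeWord_append (A : Matrix n n ℝ) (v w : List Bool) :
    transposeWord A (v ++ w) = transposeWord A v * transposeWord A w := by
  simp [transposeWord]

theorem transposeWord_cons (A : Matrix n n ℝ) (ε : Bool) (w : List Bool) :
    transposeWord A (ε :: w) = cond ε Aᵀ A * transposeWord A w := by
  simp [transposeWord]

theorem transpose_transposeWord (A : Matrix n n ℝ) (w : List Bool) :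
    (transposeWord A w)ᵀ = transposeWord A (w.map not).reverse := by
  induction w with
  | nil => simp [transposeWord]
  | cons ε w ih =>
    rw [transposeWord_cons, transpose_mul, ih, List.map_cons, List.reverse_cons,
      transposeWord_append]
    cases ε <;> simp [transposeWord]

theorem intertwines_transposeWord {A B U : Matrix n n ℝ} (h : U * A = B * U)
    (h' : U * Aᵀ = Bᵀ * U) (w : List Bool) :
    U * transposeWord A w = transposeWord B w * U := by
  induction w with
  | nil => simp [transposeWord]
  | cons ε w ih =>
    rw [transposeWord_cons, transposeWord_cons, mul_assoc, ← ih, ← mul_assoc, ← mul_assoc]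
    cases ε
    · simp [h]
    · simp [h']

/-- If the compressions of all words to two nonzero reducing subspaces have equal traces, these
subspaces carry a nonzero partially isometric intertwiner. -/
theorem exists_partial_isometry_intertwiner {A B P Q : Matrix n n ℝ} (hP : Pᵀ = P)
    (hPP : P * P = P) (hQ : Qᵀ = Q) (hQQ : Q * Q = Q) (hP0 : P ≠ 0)
    (hPA : P * A = A * P) (hPA' : P * Aᵀ = Aᵀ * P) (hQB : Q * B = B * Q)
    (hQB' : Q * Bᵀ = Bᵀ * Q)
    (htr : ∀ w, (P * transposeWord A w).trace = (Q * transposeWord B w).trace) :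
    ∃ U : Matrix n n ℝ, U ≠ 0 ∧ U * Uᵀ * U = U ∧ Q * U = U ∧ U * P = U ∧
      U * A = B * U ∧ U * Aᵀ = Bᵀ * U := by
  set D := Submodule.span ℝ
    (Set.range fun w => (P * transposeWord A w, Q * transposeWord B w)) with hDdef
  have hgram (v w : List Bool) (R M : Matrix n n ℝ) (hR : Rᵀ = R) (hRR : R * R = R)
      (hRM : R * M = M * R) (hRM' : R * Mᵀ = Mᵀ * R) :
      ((R * transposeWord M v)ᵀ * (R * transposeWord M w)).trace =
        (R * transposeWord M ((v.map not).reverse ++ w)).trace := by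
    rw [transpose_mul, hR, transposeWord_append, ← transpose_transposeWord, mul_assoc,
      ← mul_assoc R R, hRR, transpose_transposeWord, ← mul_assoc, ← mul_assoc,
      intertwines_transposeWord hRM hRM']
  have hD2 : ∀ x ∈ D, ∀ y ∈ D, (x.1ᵀ * y.1).trace = (x.2ᵀ * y.2).trace := by
    intro x hx y hy
    induction hx, hy using Submodule.span_induction₂ with
    | mem_mem x y hx hy =>
      obtain ⟨v, rfl⟩ := hx
      obtain ⟨w, rfl⟩ := hy
      exact (hgram v w P A hP hPP hPA hPA').trans
        ((htr _).trans (hgram v w Q B hQ hQQ hQB hQB').symm)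
    | zero_left y hy => simp
    | zero_right x hx => simp
    | add_left x y z _ _ _ h₁ h₂ => simp [add_mul, h₁, h₂]
    | add_right x y z _ _ _ h₁ h₂ => simp [mul_add, h₁, h₂]
    | smul_left r x y _ _ h => simp [h]
    | smul_right r x y _ _ h => simp [h]
  have hcl (ε : Bool) : ∀ x ∈ D, (cond ε Aᵀ A * x.1, cond ε Bᵀ B * x.2) ∈ D := by
    intro x hx
    have hle : D ≤ D.comap ((LinearMap.mulLeft ℝ (cond ε Aᵀ A)).prodMap
        (LinearMap.mulLeft ℝ (cond ε Bᵀ B))) := by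
      refine Submodule.span_le.2 ?_
      rintro _ ⟨w, rfl⟩
      refine Submodule.subset_span ⟨ε :: w, ?_⟩
      cases ε <;> simp [transposeWord_cons, ← mul_assoc, hPA, hPA', hQB, hQB']
    exact hle hx
  have hPD : ∀ x ∈ D, P * x.1 = x.1 ∧ Q * x.2 = x.2 := by
    intro x hx
    induction hx using Submodule.span_induction with
    | mem x hx =>
      obtain ⟨w, rfl⟩ := hx
      simp [← mul_assoc, hPP, hQQ]
    | zero => simp
    | add x y _ _ hx hy => simp [mul_add, hx, hy]
    | smul r x _ hx => simp [hx]
  have hPQ : (P, Q) ∈ D := Submodule.subset_span ⟨[], by simp [transposeWord]⟩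
  have hQ0 : Q ≠ 0 := by
    rintro rfl
    have h := hD2 _ hPQ _ hPQ
    rw [← conjTranspose_eq_transpose_of_trivial] at h
    exact hP0 (trace_conjTranspose_mul_self_eq_zero_iff.1 (by simpa using h))
  obtain ⟨T, hT0, hQT, hTP, hT⟩ := exists_ne_zero_intertwiner_s3 (fun x hx => hD2 x hx x hx) hPQ hQ0
    hP (fun x hx => (hPD x hx).1) (fun x hx => (hPD x hx).2)
  have hTA : T * A = B * T := hT A B (hcl false) (hcl true)
  have hTA' : T * Aᵀ = Bᵀ * T := hT Aᵀ Bᵀ (hcl true) (by simpa using hcl false)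
  have hTB : Tᵀ * B = A * Tᵀ := by simpa using (congrArg transpose hTA').symm
  have hTB' : Tᵀ * Bᵀ = Aᵀ * Tᵀ := by simpa using (congrArg transpose hTA).symm
  have hPT : P * Tᵀ = Tᵀ := by simpa [hP] using congrArg transpose hTP
  obtain ⟨G, hG, hGc, hG1, hG2⟩ := (posSemidef_conjTranspose_mul_self T).exists_partial_inv_sqrt
  rw [conjTranspose_eq_transpose_of_trivial] at hGc hG1 hG2
  have hGA : G * A = A * G := hGc A (by
    change _ * _ = _ * _
    rw [mul_assoc, hTA, ← mul_assoc, hTB, mul_assoc])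
  have hGA' : G * Aᵀ = Aᵀ * G := hGc Aᵀ (by
    change _ * _ = _ * _
    rw [mul_assoc, hTA', ← mul_assoc, hTB', mul_assoc])
  have hGP : G * P = P * G := hGc P (by
    change _ * _ = _ * _
    rw [mul_assoc, hTP, ← mul_assoc, hPT])
  refine ⟨T * G, fun h => hT0 ?_, ?_, ?_, ?_, ?_, ?_⟩
  · rw [mul_assoc Tᵀ, h] at hG2
    refine conjTranspose_mul_self_eq_zero.1 ?_
    rw [conjTranspose_eq_transpose_of_trivial, ← hG2]
    simp
  · rw [transpose_mul, hG]
    nth_rw 4 [← hG1]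
    simp only [mul_assoc]
  · rw [← mul_assoc, hQT]
  · rw [mul_assoc, hGP, ← mul_assoc, hTP]
  · rw [mul_assoc, hGA, ← mul_assoc, hTA, mul_assoc]
  · rw [mul_assoc, hGA', ← mul_assoc, hTA', mul_assoc]

/-- Equality of the traces of all words yields an orthogonal intertwiner: a partially isometric
intertwiner with minimal kernel. -/
theorem exists_orthogonal_intertwiner {A B : Matrix n n ℝ}
    (htr : ∀ w, (transposeWord A w).trace = (transposeWord B w).trace) :
    ∃ U : Matrix n n ℝ, Uᵀ * U = 1 ∧ U * A = B * U := by
  let s : Set (Submodule ℝ (n → ℝ)) := {K | ∃ U : Matrix n n ℝ, U * Uᵀ * U = U ∧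
    U * A = B * U ∧ U * Aᵀ = Bᵀ * U ∧ LinearMap.ker U.mulVecLin = K}
  obtain ⟨_, ⟨U, hU, hUA, hUA', rfl⟩, hmin⟩ :=
    (wellFounded_lt (α := Submodule ℝ (n → ℝ))).has_min s ⟨_, 0, by simp, by simp, by simp, rfl⟩
  refine ⟨U, ?_, hUA⟩
  by_contra hne
  have hUB : Uᵀ * B = A * Uᵀ := by simpa using (congrArg transpose hUA').symm
  have hUB' : Uᵀ * Bᵀ = Aᵀ * Uᵀ := by simpa using (congrArg transpose hUA).symm
  have hU' : Uᵀ * U * Uᵀ = Uᵀ := by simpa [mul_assoc] using congrArg transpose hU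
  obtain ⟨V, hV0, hV, hQV, hVP, hVA, hVA'⟩ :=
    exists_partial_isometry_intertwiner (A := A) (B := B) (P := 1 - Uᵀ * U) (Q := 1 - U * Uᵀ)
      (by simp)
      (by rw [sub_mul, one_mul, mul_sub, mul_one, ← mul_assoc, hU', sub_self, sub_zero])
      (by simp)
      (by rw [sub_mul, one_mul, mul_sub, mul_one, ← mul_assoc, hU, sub_self, sub_zero])
      (fun h => hne (sub_eq_zero.1 h).symm)
      (by rw [sub_mul, mul_sub, one_mul, mul_one, mul_assoc, hUA, ← mul_assoc, hUB, mul_assoc])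
      (by rw [sub_mul, mul_sub, one_mul, mul_one, mul_assoc, hUA', ← mul_assoc, hUB', mul_assoc])
      (by rw [sub_mul, mul_sub, one_mul, mul_one, mul_assoc, hUB, ← mul_assoc, hUA, mul_assoc])
      (by rw [sub_mul, mul_sub, one_mul, mul_one, mul_assoc, hUB', ← mul_assoc, hUA', mul_assoc])
      (fun w => by
        rw [sub_mul, sub_mul, one_mul, one_mul, trace_sub, trace_sub, htr, mul_assoc,
          intertwines_transposeWord hUA hUA', trace_mul_comm, mul_assoc,
          trace_mul_comm (transposeWord B w)])
  have hUV : Uᵀ * V = 0 := by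
    rw [← hQV, ← mul_assoc, mul_sub, mul_one, ← mul_assoc, hU', sub_self, zero_mul]
  have hVU : V * Uᵀ = 0 := by
    rw [← hVP, mul_assoc, sub_mul, one_mul, hU', sub_self, mul_zero]
  have hVU' : Vᵀ * U = 0 := by simpa using congrArg transpose hUV
  have hUV' : U * Vᵀ = 0 := by simpa using congrArg transpose hVU
  refine hmin (LinearMap.ker (U + V).mulVecLin) ⟨U + V, ?_, ?_, ?_, rfl⟩ ?_
  · rw [transpose_add, add_mul, mul_add U, mul_add V, hVU, hUV', zero_add, add_zero, add_mul, mul_add,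
      mul_add, hU, hV, mul_assoc, hUV, mul_assoc, hVU', mul_zero, mul_zero, zero_add, add_zero]
  · rw [add_mul, mul_add, hUA, hVA]
  · rw [add_mul, mul_add, hUA', hVA']
  · refine lt_of_le_of_ne (fun x hx => ?_) fun h => hV0 ?_
    · simp only [LinearMap.mem_ker, mulVecLin_apply] at hx ⊢
      have hUU : U * Uᵀ * (U + V) = U := by rw [mul_add, hU, mul_assoc, hUV, mul_zero, add_zero]
      rw [← hUU, ← mulVec_mulVec, hx, mulVec_zero]
    · refine ext_of_mulVec_single fun i => ?_
      have hmem : (Vᵀ * V) *ᵥ Pi.single i 1 ∈ LinearMap.ker U.mulVecLin := by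
        rw [LinearMap.mem_ker, mulVecLin_apply, mulVec_mulVec, ← mul_assoc, hUV', zero_mul,
          zero_mulVec]
      rw [← h, LinearMap.mem_ker, mulVecLin_apply, mulVec_mulVec, ← mul_assoc, add_mul, hUV',
        zero_add, hV] at hmem
      rw [hmem, zero_mulVec]

end

/-- **Specht's criterion for real orthogonal similarity.**
Two `n × n` real matrices `A` and `B` are real orthogonally similar (`B = S⁻¹ * A * S` for
some real matrix `S` with `Sᵀ * S = 1`) iff `trace w(A, Aᵀ) = trace w(B, Bᵀ)` for every
word `w(x, y)` in two noncommuting variables.  A word is encoded as a nonempty list of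
Booleans, `false` standing for the matrix itself and `true` for its transpose. -/
theorem specht_real_orthogonal_similarity (n : ℕ) (A B : Matrix (Fin n) (Fin n) ℝ) :
    (∃ S : Matrix (Fin n) (Fin n) ℝ, Sᵀ * S = 1 ∧ B = S⁻¹ * A * S) ↔
    (∀ w : List Bool, w ≠ [] →
      ((w.map fun ε => cond ε Aᵀ A).prod).trace =
      ((w.map fun ε => cond ε Bᵀ B).prod).trace) := by
  constructor
  · rintro ⟨S, hS, rfl⟩ w -
    have hS' : S * Sᵀ = 1 := mul_eq_one_comm.1 hS
    rw [inv_eq_left_inv hS]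
    have h := intertwines_transposeWord (A := A) (B := Sᵀ * A * S) (U := Sᵀ)
      (by rw [mul_assoc (Sᵀ * A), hS', mul_one])
      (by simp [mul_assoc, hS']) w
    change (transposeWord A w).trace = (transposeWord _ w).trace
    rw [← mul_one (transposeWord (Sᵀ * A * S) w), ← hS, ← mul_assoc, ← h, trace_mul_comm,
      ← mul_assoc, hS', one_mul]
  · intro h
    obtain ⟨U, hU, hUA⟩ := exists_orthogonal_intertwiner (A := A) (B := B) fun w => by
      rcases eq_or_ne w [] with rfl | hw
      · simp [transposeWord]
      · exact h w hw
    have hU' : U * Uᵀ = 1 := mul_eq_one_comm.1 hU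
    refine ⟨Uᵀ, by simpa using hU', ?_⟩
    rw [inv_eq_left_inv (B := U) (by simpa using hU'), hUA, mul_assoc, hU', mul_one]
end

section
/- Let (A₁,…,A_k) and (B₁,…,B_k) be two k-tuples of n×n real matrices. There exists a real orthogonal matrix S (i.e., SᵀS = I) such that S⁻¹A_iS = B_i for every i = 1,…,k if and only if for every nonempty finite sequence (i₁,ε₁),…,(i_ℓ,ε_ℓ) with each i_j ∈ {1,…,k} and each ε_j ∈ {1,T}, trace(A_{i₁}^{(ε₁)}···A_{i_ℓ}^{(ε_ℓ)}) = trace(B_{i₁}^{(ε₁)}···B_{i_ℓ}^{(ε_ℓ)}), where M^{(1)} = M and M^{(T)} = Mᵀ. -/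
open Matrix

namespace Matrix

variable {N : Type*} [Fintype N]

theorem trace_star (M : Matrix N N ℝ) : (star M).trace = M.trace :=
  M.trace_conjTranspose.trans (star_trivial _)

theorem _root_.IsStarProjection.eq_zero_of_trace_eq_zero {p : Matrix N N ℝ}
    (hp : IsStarProjection p) (h : p.trace = 0) : p = 0 := by
  rw [← trace_conjTranspose_mul_self_eq_zero_iff, ← star_eq_conjTranspose,
    hp.isSelfAdjoint.star_eq, hp.isIdempotentElem.eq, h]

variable [DecidableEq N]

theorem _root_.IsStarProjection.exists_trace_eq_natCast {p : Matrix N N ℝ}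
    (hp : IsStarProjection p) : ∃ m : ℕ, p.trace = m := by
  have h : IsIdempotentElem (toLin' p) := by
    rw [IsIdempotentElem, Module.End.mul_eq_comp, ← toLin'_mul, hp.isIdempotentElem.eq]
  exact ⟨_, (trace_toLin'_eq p).symm.trans (LinearMap.IsIdempotentElem.isProj_range _ h).trace⟩

theorem exists_orthonormal_frame (S : Submodule ℝ (Matrix N N ℝ)) :
    ∃ (d : ℕ) (e : Fin d → Matrix N N ℝ), (∀ j, e j ∈ S) ∧
      ∀ x ∈ S, x = ∑ j, (star (e j) * x).trace • e j := by
  let _ : NormedAddCommGroup (Matrix N N ℝ) := toMatrixNormedAddCommGroup 1 PosDef.one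
  let _ : InnerProductSpace ℝ (Matrix N N ℝ) := toMatrixInnerProductSpace 1 PosDef.one.posSemidef
  let b := stdOrthonormalBasis ℝ S
  refine ⟨_, fun j => (b j : Matrix N N ℝ), fun j => (b j).2, fun x hx => ?_⟩
  have h := congrArg Subtype.val (b.sum_repr' ⟨x, hx⟩)
  rw [Submodule.coe_sum] at h
  refine h.symm.trans (Finset.sum_congr rfl fun j _ => ?_)
  rw [Submodule.coe_smul]
  congr 1
  change (x * 1 * star (b j : Matrix N N ℝ)).trace = _
  rw [mul_one, trace_mul_comm]

/-- Averaging over an orthonormal frame of a star subalgebra produces elements of its commutant. -/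
theorem commute_sum_frame (S : StarSubalgebra ℝ (Matrix N N ℝ)) {d : ℕ}
    {e : Fin d → Matrix N N ℝ} (he : ∀ j, e j ∈ S)
    (hS : ∀ x ∈ S, x = ∑ j, (star (e j) * x).trace • e j) (X : Matrix N N ℝ)
    {a : Matrix N N ℝ} (ha : a ∈ S) :
    Commute a (∑ j, e j * X * star (e j)) := by
  have hleft (j) : a * e j = ∑ i, (star (e i) * (a * e j)).trace • e i :=
    hS _ (mul_mem ha (he j))
  have hright (i) : star (e i) * a = ∑ j, (star (e i) * (a * e j)).trace • star (e j) := by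
    have h := congrArg star (hS _ (mul_mem (star_mem ha) (he i)))
    rw [star_mul, star_star, star_sum] at h
    refine h.trans (Finset.sum_congr rfl fun j _ => ?_)
    rw [star_smul, star_trivial]
    congr 1
    rw [← trace_star, star_mul, star_mul, star_star, star_star, mul_assoc]
  rw [commute_iff_eq, Finset.mul_sum, Finset.sum_mul]
  calc ∑ j, a * (e j * X * star (e j))
      = ∑ j, ∑ i, (star (e i) * (a * e j)).trace • (e i * X * star (e j)) := by
        refine Finset.sum_congr rfl fun j _ => ?_
        rw [← mul_assoc, ← mul_assoc]
        nth_rw 1 [hleft j]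
        simp [Finset.sum_mul]
    _ = ∑ i, ∑ j, (star (e i) * (a * e j)).trace • (e i * X * star (e j)) := Finset.sum_comm
    _ = ∑ i, e i * X * star (e i) * a := by
        refine Finset.sum_congr rfl fun i _ => ?_
        rw [mul_assoc _ _ a, hright i]
        simp [Finset.mul_sum]

/-- Projections in the commutant of `S` with equal trace functionals on `S` are not disjoint. -/
theorem exists_commute_ne_zero (S : StarSubalgebra ℝ (Matrix N N ℝ)) {p q : Matrix N N ℝ}
    (hp : IsStarProjection p) (hq : IsStarProjection q) (hp0 : p ≠ 0)
    (hpS : ∀ a ∈ S, Commute a p) (hqS : ∀ a ∈ S, Commute a q)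
    (htr : ∀ a ∈ S, (p * a).trace = (q * a).trace) :
    ∃ T, T ≠ 0 ∧ (∀ a ∈ S, Commute a T) ∧ q * T = T ∧ T * p = T := by
  obtain ⟨d, e, he, hS⟩ := exists_orthonormal_frame S.toSubalgebra.toSubmodule
  by_contra! hT
  have hX (X : Matrix N N ℝ) : q * (∑ j, e j * X * star (e j)) * p = 0 := by
    by_contra h0
    refine hT _ h0 (fun a ha => ((hqS a ha).mul_right
      (commute_sum_frame S he hS X ha)).mul_right (hpS a ha)) ?_ ?_
    · rw [← mul_assoc, ← mul_assoc, hq.isIdempotentElem.eq]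
    · rw [mul_assoc, hp.isIdempotentElem.eq]
  have hsum : ∑ j, (q * e j).trace * (star (e j) * p).trace = 0 := by
    have h (u v : N) : ∑ j, (q * e j) u u * (star (e j) * p) v v = 0 := by
      have := congrFun (congrFun (hX (single u v 1)) u) v
      rw [Finset.mul_sum, Finset.sum_mul, sum_apply, zero_apply] at this
      rw [← this]
      refine Finset.sum_congr rfl fun j _ => ?_
      rw [show q * (e j * single u v 1 * star (e j)) * p =
        (q * e j) * single u v 1 * (star (e j) * p) by noncomm_ring,
        mul_apply (M := q * e j * single u v 1),
        Finset.sum_eq_single v (fun w _ hw => by simp [mul_single_apply_of_ne _ _ _ _ _ hw])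
          (by simp), mul_single_apply_same, mul_one]
    calc _ = ∑ j, ∑ u, ∑ v, (q * e j) u u * (star (e j) * p) v v := by
          simp only [trace, diag_apply, Finset.sum_mul_sum]
      _ = ∑ u, ∑ v, ∑ j, (q * e j) u u * (star (e j) * p) v v := by
          rw [Finset.sum_comm]
          exact Finset.sum_congr rfl fun u _ => Finset.sum_comm
      _ = 0 := by simp [h]
  have hpe (j) : (star (e j) * p).trace = (p * e j).trace := by
    rw [← trace_star, star_mul, star_star, hp.isSelfAdjoint.star_eq]
  have hzero (j) : (p * e j).trace = 0 := by
    simp only [hpe, ← htr _ (he _)] at hsum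
    exact mul_self_eq_zero.1
      ((Finset.sum_eq_zero_iff_of_nonneg fun _ _ => mul_self_nonneg _).1 hsum j (Finset.mem_univ j))
  refine hp0 (hp.eq_zero_of_trace_eq_zero ?_)
  have h1 := congrArg (fun x => (p * x).trace) (hS 1 (one_mem S))
  simpa [Finset.mul_sum, trace_sum, hzero] using h1

/-- A nonzero matrix `T` becomes a nonzero partial isometry after multiplication by a function of
`star T * T`. -/
theorem exists_partialIsometry_mul_right {T : Matrix N N ℝ} (hT : T ≠ 0) :
    ∃ R : Matrix N N ℝ, (∀ a, Commute (star T * T) a → Commute R a) ∧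
      T * R ≠ 0 ∧ T * R * star (T * R) * (T * R) = T * R := by
  have hH : IsSelfAdjoint (star T * T) := .star_mul_self T
  set H := star T * T with hHdef
  have hfin : (spectrum ℝ H).Finite := Matrix.finite_real_spectrum
  have hc (g : ℝ → ℝ) : ContinuousOn g (spectrum ℝ H) := hfin.continuousOn g
  have hpos : ∀ x ∈ spectrum ℝ H, 0 ≤ x := fun x hx =>
    (posSemidef_iff_isHermitian_and_spectrum_nonneg.1 (posSemidef_conjTranspose_mul_self T)).2 hx
  let f : ℝ → ℝ := fun x => (√x)⁻¹
  have hR : IsSelfAdjoint (cfc f H) := cfc_predicate f H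
  have hHR : H * cfc f H * cfc Real.sqrt H = H := by
    conv_lhs => enter [1, 1]; rw [← cfc_id' ℝ H]
    rw [← cfc_mul _ _ H (hc _) (hc _), ← cfc_mul _ _ H (hc _) (hc _)]
    conv_rhs => rw [← cfc_id' ℝ H]
    refine cfc_congr fun x hx => ?_
    rcases (hpos x hx).eq_or_lt with rfl | h
    · simp
    · have := (Real.sqrt_pos.2 h).ne'
      simp [f, this]
  have hRHR : cfc f H * cfc f H * H * cfc f H = cfc f H := by
    conv_lhs => enter [1, 2]; rw [← cfc_id' ℝ H]
    rw [← cfc_mul _ _ H (hc _) (hc _), ← cfc_mul _ _ H (hc _) (hc _),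
      ← cfc_mul _ _ H (hc _) (hc _)]
    refine cfc_congr fun x hx => ?_
    rcases (hpos x hx).eq_or_lt with rfl | h
    · simp [f]
    · have := (Real.sqrt_pos.2 h).ne'
      have h2 := Real.sq_sqrt h.le
      simp only [f]
      field_simp
      exact h2.symm
  refine ⟨cfc f H, fun a ha => ha.cfc_real f, fun h0 => hT ?_, ?_⟩
  · rw [← conjTranspose_mul_self_eq_zero]
    change H = 0
    rw [← hHR, hHdef, mul_assoc (star T), h0]
    simp
  · rw [star_mul, hR.star_eq]
    calc T * cfc f H * (cfc f H * star T) * (T * cfc f H)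
        = T * (cfc f H * cfc f H * H * cfc f H) := by rw [hHdef]; noncomm_ring
      _ = _ := by rw [hRHR]

/-- Projections in the commutant of a star algebra of matrices which define the same trace
functional on it are Murray-von Neumann equivalent in the commutant. -/
theorem exists_partialIsometry_of_trace_eq (S : StarSubalgebra ℝ (Matrix N N ℝ))
    {p q : Matrix N N ℝ} (hp : IsStarProjection p) (hq : IsStarProjection q)
    (hpS : ∀ a ∈ S, Commute a p) (hqS : ∀ a ∈ S, Commute a q)
    (htr : ∀ a ∈ S, (p * a).trace = (q * a).trace) :
    ∃ U, (∀ a ∈ S, Commute a U) ∧ q * U = U ∧ U * p = U ∧ star U * U = p ∧ U * star U = q := by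
  obtain ⟨m, hm⟩ := hp.exists_trace_eq_natCast
  induction m using Nat.strong_induction_on generalizing p q with
  | _ m ih =>
  by_cases hp0 : p = 0
  · have hq0 : q = 0 := hq.eq_zero_of_trace_eq_zero (by
      simpa [hp0] using (htr 1 (one_mem S)).symm)
    exact ⟨0, by simp [hp0, hq0]⟩
  obtain ⟨T, hT0, hTS, hqT, hTp⟩ := exists_commute_ne_zero S hp hq hp0 hpS hqS htr
  obtain ⟨R, hRc, hW0, hW⟩ := exists_partialIsometry_mul_right hT0
  have star_commute {V : Matrix N N ℝ} (hV : ∀ a ∈ S, Commute a V) :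
      ∀ a ∈ S, Commute a (star V) := fun a ha => by
    simpa using (hV _ (star_mem ha)).star_star
  have hpT : p * star T = star T := by
    rw [← hp.isSelfAdjoint.star_eq, ← star_mul, hTp]
  have hRp : R * p = p * R := hRc p (by
    rw [commute_iff_eq, mul_assoc, hTp, ← mul_assoc, hpT])
  have hqW : q * (T * R) = T * R := by rw [← mul_assoc, hqT]
  have hWp : T * R * p = T * R := by rw [mul_assoc, hRp, ← mul_assoc, hTp]
  have hWS : ∀ a ∈ S, Commute a (T * R) := fun a ha =>
    (hTS a ha).mul_right (hRc a (((star_commute hTS a ha).mul_right (hTS a ha)).symm)).symm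
  generalize T * R = W at hW0 hW hqW hWp hWS
  have hWS' := star_commute hWS
  have hpW : p * star W = star W := by
    rw [← hp.isSelfAdjoint.star_eq, ← star_mul, hWp]
  have hWq : star W * q = star W := by
    rw [← hq.isSelfAdjoint.star_eq, ← star_mul, hqW]
  have hW' : star W * W * star W = star W := by
    simpa [mul_assoc] using congrArg star hW
  have hWW : IsStarProjection (star W * W) :=
    ⟨by rw [IsIdempotentElem, ← mul_assoc, hW'], .star_mul_self W⟩
  have hWW' : IsStarProjection (W * star W) :=
    ⟨by rw [IsIdempotentElem, ← mul_assoc, hW], .mul_star_self W⟩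
  have hp' : IsStarProjection (p - star W * W) :=
    hWW.sub_of_mul_eq_left hp (by rw [mul_assoc, hWp])
  have hq' : IsStarProjection (q - W * star W) :=
    hWW'.sub_of_mul_eq_left hq (by rw [mul_assoc, hWq])
  obtain ⟨m', hm'⟩ := hp'.exists_trace_eq_natCast
  have hlt : m' < m := by
    have hpos : 0 < (star W * W).trace :=
      (posSemidef_conjTranspose_mul_self W).trace_nonneg.lt_of_ne fun h =>
        hW0 (trace_conjTranspose_mul_self_eq_zero_iff.1 h.symm)
    rw [trace_sub, hm] at hm'
    exact_mod_cast (by linarith : (m' : ℝ) < m)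
  obtain ⟨U, hUS, hqU, hUp, hUU, hUU'⟩ := ih m' hlt hp' hq'
    (fun a ha => (hpS a ha).sub_right ((hWS' a ha).mul_right (hWS a ha)))
    (fun a ha => (hqS a ha).sub_right ((hWS a ha).mul_right (hWS' a ha)))
    (fun a ha => by
      rw [sub_mul, sub_mul, trace_sub, trace_sub, htr a ha, mul_assoc W (star W) a,
        trace_mul_comm W, mul_assoc (star W) a W, (hWS a ha).eq, ← mul_assoc]) hm'
  have hUW : star U * W = 0 := by
    rw [← hqU, star_mul, hq'.isSelfAdjoint.star_eq, mul_assoc, sub_mul, hqW, hW, sub_self, mul_zero]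
  have hWU : star W * U = 0 := by simpa using congrArg star hUW
  have hUW' : U * star W = 0 := by
    rw [← hUp, mul_assoc, sub_mul, hpW, hW', sub_self, mul_zero]
  have hWU' : W * star U = 0 := by simpa using congrArg star hUW'
  refine ⟨U + W, fun a ha => (hUS a ha).add_right (hWS a ha), ?_, ?_, ?_, ?_⟩
  · rw [mul_add, hqW, ← hqU, ← mul_assoc, mul_sub, hq.isIdempotentElem.eq, ← mul_assoc, hqW]
  · rw [add_mul, hWp, ← hUp, mul_assoc, sub_mul, hp.isIdempotentElem.eq, mul_assoc, hWp]
  · rw [star_add, add_mul, mul_add, mul_add, hUU, hUW, hWU]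
    abel
  · rw [star_add, add_mul, mul_add, mul_add, hUU', hUW', hWU']
    abel

end Matrix

/-- **Simultaneous real orthogonal similarity criterion.**
Two `k`-tuples `(A₁, …, A_k)` and `(B₁, …, B_k)` of `n × n` real matrices are
simultaneously real orthogonally similar iff the traces of all words in
`A₁, A₁ᵀ, …, A_k, A_kᵀ` and `B₁, B₁ᵀ, …, B_k, B_kᵀ` coincide.  A word is encoded as a
nonempty list of pairs `(i, ε)` with `i : Fin k` and `ε : Bool`, where `ε = false` stands
for the matrix itself and `ε = true` for its transpose. -/
theorem simultaneous_real_orthogonal_similarity (n k : ℕ)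
    (A B : Fin k → Matrix (Fin n) (Fin n) ℝ) :
    (∃ S : Matrix (Fin n) (Fin n) ℝ, Sᵀ * S = 1 ∧ ∀ i : Fin k, S⁻¹ * A i * S = B i) ↔
    (∀ w : List (Fin k × Bool), w ≠ [] →
      ((w.map fun p => cond p.2 (A p.1)ᵀ (A p.1)).prod).trace =
      ((w.map fun p => cond p.2 (B p.1)ᵀ (B p.1)).prod).trace) := by
  refine ⟨?_, fun h => ?_⟩
  · rintro ⟨S, hS, hAB⟩ w -
    have hS' : S * Sᵀ = 1 := mul_eq_one_comm.1 hS
    have hinv : S⁻¹ = Sᵀ := inv_eq_left_inv hS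
    have hB (p : Fin k × Bool) :
        cond p.2 (B p.1)ᵀ (B p.1) = Sᵀ * cond p.2 (A p.1)ᵀ (A p.1) * S := by
      obtain ⟨i, _ | _⟩ := p <;> simp [← hAB, hinv, mul_assoc]
    have hprod : (w.map fun p => cond p.2 (B p.1)ᵀ (B p.1)).prod =
        Sᵀ * (w.map fun p => cond p.2 (A p.1)ᵀ (A p.1)).prod * S := by
      induction w with
      | nil => simp [hS]
      | cons p w ih =>
        rw [List.map_cons, List.prod_cons, List.map_cons, List.prod_cons, ih, hB]
        simp only [mul_assoc]
        rw [← mul_assoc S, hS', one_mul]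
    rw [hprod, trace_mul_comm, ← mul_assoc, hS', one_mul]
  · let C (i : Fin k) : Matrix (Fin n ⊕ Fin n) (Fin n ⊕ Fin n) ℝ := fromBlocks (A i) 0 0 (B i)
    let p : Matrix (Fin n ⊕ Fin n) (Fin n ⊕ Fin n) ℝ := fromBlocks 1 0 0 0
    let q : Matrix (Fin n ⊕ Fin n) (Fin n ⊕ Fin n) ℝ := fromBlocks 0 0 0 1
    let S := StarAlgebra.adjoin ℝ (Set.range C)
    have hC (i) : C i ∈ S := StarAlgebra.subset_adjoin ℝ _ ⟨i, rfl⟩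
    have hp : IsStarProjection p := by
      constructor <;>
        simp [p, IsIdempotentElem, IsSelfAdjoint, star_eq_conjTranspose, fromBlocks_multiply,
          fromBlocks_transpose]
    have hq : IsStarProjection q := by
      constructor <;>
        simp [q, IsIdempotentElem, IsSelfAdjoint, star_eq_conjTranspose, fromBlocks_multiply,
          fromBlocks_transpose]
    have hcomm {r : Matrix (Fin n ⊕ Fin n) (Fin n ⊕ Fin n) ℝ} (hr : IsSelfAdjoint r)
        (hCr : ∀ i, Commute (C i) r) : ∀ a ∈ S, Commute a r := fun a ha => by
      induction ha using StarAlgebra.adjoin_induction with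
      | mem x hx => obtain ⟨i, rfl⟩ := hx; exact hCr i
      | algebraMap c => exact Algebra.commutes c r
      | add x y _ _ hx hy => exact hx.add_left hy
      | mul x y _ _ hx hy => exact hx.mul_left hy
      | star x _ hx => simpa [hr.star_eq] using hx.star_star
    have htr : ∀ a ∈ S, (p * a).trace = (q * a).trace := by
      intro a ha
      replace ha : a ∈ S.toSubalgebra.toSubmodule := ha
      rw [StarAlgebra.adjoin_eq_span] at ha
      induction ha using Submodule.span_induction with
      | zero => simp
      | add x y _ _ hx hy => simp [mul_add, hx, hy]
      | smul c x _ hx => simp [hx]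
      | mem x hx =>
        obtain ⟨w, rfl⟩ : ∃ w : List (Fin k × Bool), fromBlocks
            (w.map fun p => cond p.2 (A p.1)ᵀ (A p.1)).prod 0 0
            (w.map fun p => cond p.2 (B p.1)ᵀ (B p.1)).prod = x := by
          induction hx using Submonoid.closure_induction_left with
          | one => exact ⟨[], by simp⟩
          | mul_left y hy z _ hz =>
            obtain ⟨w, rfl⟩ := hz
            obtain ⟨i, rfl⟩ | ⟨i, hi⟩ := hy
            · exact ⟨(i, false) :: w, by simp [C, fromBlocks_multiply]⟩
            · obtain rfl := star_eq_iff_star_eq.1 hi.symm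
              exact ⟨(i, true) :: w, by
                simp [C, fromBlocks_multiply, star_eq_conjTranspose, fromBlocks_transpose,
                  conjTranspose_eq_transpose_of_trivial]⟩
        by_cases hw : w = []
        · simp [hw, p, q, trace]
        · simpa [p, q, fromBlocks_multiply, trace] using h w hw
    obtain ⟨U, hUS, hqU, hUp, hUU, hUU'⟩ := exists_partialIsometry_of_trace_eq S hp hq
      (hcomm hp.isSelfAdjoint fun i => by
        simp [p, C, commute_iff_eq, fromBlocks_multiply])
      (hcomm hq.isSelfAdjoint fun i => by
        simp [q, C, commute_iff_eq, fromBlocks_multiply]) htr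
    obtain ⟨V, rfl⟩ : ∃ V, fromBlocks 0 0 V 0 = U := by
      refine ⟨U.toBlocks₂₁, ?_⟩
      rw [← hqU, ← hUp, ← fromBlocks_toBlocks U]
      simp [p, q, fromBlocks_multiply]
    simp only [p, q, star_eq_conjTranspose, fromBlocks_transpose, fromBlocks_multiply,
      conjTranspose_eq_transpose_of_trivial, transpose_zero, mul_zero, zero_mul, add_zero,
      zero_add, fromBlocks_inj] at hUU hUU'
    have hVV : V * Vᵀ = 1 := hUU'.2.2.2
    refine ⟨Vᵀ, by rw [transpose_transpose, hVV], fun i => ?_⟩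
    have hi : B i * V = V * A i := by
      have := (hUS _ (hC i)).eq
      simp only [C, fromBlocks_multiply, mul_zero, zero_mul, add_zero, zero_add,
        fromBlocks_inj] at this
      exact this.2.2.1
    rw [inv_eq_left_inv hVV, ← hi, mul_assoc, hVV, mul_one]
end

section
/- Let Q be a quiver with finitely many vertices 1,…,t, with finitely many arrows, and let A and B be complex matrix representations of Q of the same dimension (d₁,…,d_t), i.e., assignments to each arrow α: u → v of complex d_v×d_u matrices A_α and B_α. Then A and B are unitarily isometric — i.e., there exist unitary matrices U₁,…,U_t (U_v of size d_v×d_v) with B_α = U_v⁻¹ A_α U_u for every arrow α: u → v — if and only if trace Ã(π) = trace B̃(π) for every oriented cycle π in the doubled quiver Q̃, where Ã assigns A_α to each original arrow α and the conjugate transpose A_αᴴ to each reversed arrow α*: v → u. -/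
open Matrix Quiver

/-- The product of the matrices assigned by a matrix representation `A` along a directed
path: for the path `α₁ : v₂ → v₁, α₂ : v₃ → v₂, …, α_ℓ : v_{ℓ+1} → v_ℓ` (read from the
end of the path backwards) it is the product `A_{α₁} * A_{α₂} * ⋯ * A_{α_ℓ}`. -/
noncomputable def pathMatrixC {V : Type} [Quiver V] (d : V → ℕ)
    (A : ∀ u v : V, (u ⟶ v) → Matrix (Fin (d v)) (Fin (d u)) ℂ) :
    ∀ {u v : V}, Path u v → Matrix (Fin (d v)) (Fin (d u)) ℂ
  | _, _, Path.nil => 1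
  | _, _, Path.cons p e => A _ _ e * pathMatrixC d A p

/-- The matrix representation of the doubled quiver `Symmetrify V` induced by a matrix
representation `A` of `V`: original arrows keep their matrices, and each reversed arrow
gets the conjugate transpose of the matrix of the corresponding original arrow. -/
noncomputable def doubledRepH {V : Type} [Quiver V] (d : V → ℕ)
    (A : ∀ u v : V, (u ⟶ v) → Matrix (Fin (d v)) (Fin (d u)) ℂ) :
    ∀ u v : Symmetrify V, (u ⟶ v) → Matrix (Fin (d v)) (Fin (d u)) ℂ :=
  fun _ _ e => match e with
    | Sum.inl a => A _ _ a
    | Sum.inr a => (A _ _ a)ᴴ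

/-- Every subspace of matrices has a finite orthonormal basis for the Frobenius inner product. -/
theorem exists_frobenius_parseval_family {n : Type} [Fintype n]
    (S : Submodule ℂ (Matrix n n ℂ)) :
    ∃ (m : ℕ) (a : Fin m → Matrix n n ℂ), (∀ i, a i ∈ S) ∧
      ∀ x ∈ S, ∑ i, ((a i)ᴴ * x).trace • a i = x := by
  let f : Matrix n n ℂ ≃ₗ[ℂ] EuclideanSpace ℂ (n × n) :=
    (Matrix.ofLinearEquiv ℂ).symm ≪≫ₗ (LinearEquiv.curry ℂ ℂ n n).symm ≪≫ₗ
      (WithLp.linearEquiv 2 ℂ (n × n → ℂ)).symm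
  have hf (x y : Matrix n n ℂ) : inner ℂ (f x) (f y) = (xᴴ * y).trace := by
    simp only [PiLp.inner_apply, Fintype.sum_prod_type, Matrix.trace, Matrix.diag_apply,
      Matrix.mul_apply, Matrix.conjTranspose_apply]
    rw [Finset.sum_comm]
    refine Finset.sum_congr rfl fun i _ => Finset.sum_congr rfl fun j _ => ?_
    change inner ℂ (x j i) (y j i) = _
    simp [mul_comm]
  let b := stdOrthonormalBasis ℂ (S.map (f : Matrix n n ℂ →ₗ[ℂ] EuclideanSpace ℂ (n × n)))
  refine ⟨_, fun i => f.symm (b i), fun i => ?_, fun x hx => ?_⟩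
  · obtain ⟨y, hy, h⟩ := (b i).2
    change f.symm (b i) ∈ S
    rw [← h]
    simpa using hy
  · have h := congrArg Subtype.val (b.sum_repr' ⟨f x, x, hx, rfl⟩)
    apply f.injective
    simp only [map_sum, map_smul, LinearEquiv.apply_symm_apply, ← hf]
    simpa using h

/-- The average of `X` over a Parseval family of a star-subalgebra lies in its commutant. -/
theorem commute_sum_mul_mul_conjTranspose {n : Type} [Fintype n] [DecidableEq n]
    (D : StarSubalgebra ℂ (Matrix n n ℂ)) {m : ℕ} {a : Fin m → Matrix n n ℂ}
    (ha : ∀ i, a i ∈ D) (h : ∀ x ∈ D, ∑ i, ((a i)ᴴ * x).trace • a i = x)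
    (X : Matrix n n ℂ) {b : Matrix n n ℂ} (hb : b ∈ D) :
    Commute b (∑ i, a i * X * (a i)ᴴ) := by
  have h₁ (i : Fin m) : b * a i = ∑ k, ((a k)ᴴ * (b * a i)).trace • a k :=
    (h _ (mul_mem hb (ha i))).symm
  have h₂ (k : Fin m) : (a k)ᴴ * b = ∑ i, ((a k)ᴴ * (b * a i)).trace • (a i)ᴴ := by
    have := congrArg conjTranspose (h _ (mul_mem (star_mem hb) (ha k)))
    simp only [star_eq_conjTranspose, conjTranspose_sum, conjTranspose_smul,
      ← trace_conjTranspose, conjTranspose_mul, conjTranspose_conjTranspose] at this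
    simpa only [mul_assoc] using this.symm
  have l : b * ∑ i, a i * X * (a i)ᴴ
      = ∑ i, ∑ k, ((a k)ᴴ * (b * a i)).trace • (a k * X * (a i)ᴴ) := by
    rw [Finset.mul_sum]
    refine Finset.sum_congr rfl fun i _ => ?_
    rw [← mul_assoc, ← mul_assoc, h₁, Finset.sum_mul, Finset.sum_mul]
    simp only [smul_mul_assoc, ← h₁]
  have r : (∑ k, a k * X * (a k)ᴴ) * b
      = ∑ k, ∑ i, ((a k)ᴴ * (b * a i)).trace • (a k * X * (a i)ᴴ) := by
    rw [Finset.sum_mul]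
    refine Finset.sum_congr rfl fun k _ => ?_
    rw [mul_assoc, h₂, Finset.mul_sum]
    simp only [mul_smul_comm]
  rw [Commute, SemiconjBy, l, r, Finset.sum_comm]

theorem sum_mul_single_mul_apply {n : Type} [Fintype n] [DecidableEq n] (x y : Matrix n n ℂ) :
    ∑ j, ∑ k, (x * Matrix.single j k 1 * y : Matrix n n ℂ) j k = x.trace * y.trace := by
  simp only [Matrix.trace, Matrix.diag_apply, Finset.sum_mul_sum]
  refine Finset.sum_congr rfl fun j _ => Finset.sum_congr rfl fun k _ => ?_
  simp [Matrix.mul_apply, Matrix.single_apply, ite_and]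

theorem IsStarProjection.eq_zero_of_trace_eq_zero_s9 {n : Type} [Fintype n]
    {p : Matrix n n ℂ} (hp : IsStarProjection p) (h : p.trace = 0) : p = 0 := by
  classical
  open scoped ComplexOrder in
  rw [← Matrix.trace_conjTranspose_mul_self_eq_zero_iff, ← star_eq_conjTranspose,
    hp.isSelfAdjoint.star_eq, hp.isIdempotentElem.eq, h]

/-- Two projections in the commutant of a star-subalgebra on which their trace functionals agree
are connected by a nonzero element of the commutant. -/
theorem exists_commutant_ne_zero {n : Type} [Fintype n] [DecidableEq n]
    (D : StarSubalgebra ℂ (Matrix n n ℂ)) {p q : Matrix n n ℂ}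
    (hp : IsStarProjection p) (hq : IsStarProjection q)
    (hpD : ∀ a ∈ D, Commute a p) (hqD : ∀ a ∈ D, Commute a q)
    (h : ∀ a ∈ D, (p * a).trace = (q * a).trace) (hp0 : p ≠ 0) :
    ∃ t : Matrix n n ℂ, t ≠ 0 ∧ (∀ a ∈ D, Commute a t) ∧ t * p = t ∧ q * t = t := by
  obtain ⟨m, a, ha, hpar⟩ :=
    exists_frobenius_parseval_family (Subalgebra.toSubmodule D.toSubalgebra)
  replace ha : ∀ i, a i ∈ D := ha
  replace hpar : ∀ x ∈ D, ∑ i, ((a i)ᴴ * x).trace • a i = x := hpar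
  by_contra! hcon
  have hzero (X : Matrix n n ℂ) : q * (∑ i, a i * X * (a i)ᴴ) * p = 0 := by
    by_contra h0
    refine hcon _ h0 (fun b hb => ?_) ?_ ?_
    · exact ((hqD b hb).mul_right (commute_sum_mul_mul_conjTranspose D ha hpar X hb)).mul_right
        (hpD b hb)
    · rw [mul_assoc, hp.isIdempotentElem.eq]
    · simp only [← mul_assoc, hq.isIdempotentElem.eq]
  have hsum : ∑ i, (p * a i).trace * star (p * a i).trace = 0 := by
    have key (i : Fin m) : (p * a i).trace * star (p * a i).trace
        = ∑ j, ∑ k, (q * a i * Matrix.single j k 1 * ((a i)ᴴ * p) : Matrix n n ℂ) j k := by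
      rw [sum_mul_single_mul_apply, ← h _ (ha i), ← trace_conjTranspose, conjTranspose_mul,
        ← star_eq_conjTranspose p, hp.isSelfAdjoint.star_eq]
    simp only [key]
    rw [Finset.sum_comm]
    refine Finset.sum_eq_zero fun j _ => ?_
    rw [Finset.sum_comm]
    refine Finset.sum_eq_zero fun k _ => ?_
    have := congrFun (congrFun (hzero (Matrix.single j k 1)) j) k
    simp only [Finset.mul_sum, Finset.sum_mul, Matrix.sum_apply, ← mul_assoc] at this ⊢
    exact this
  have htr (i : Fin m) : (p * a i).trace = 0 := by
    have h1 : ∑ i, Complex.normSq (p * a i).trace = 0 := by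
      have := congrArg Complex.re hsum
      simpa [Complex.mul_conj, -Complex.mul_re] using this
    rw [Finset.sum_eq_zero_iff_of_nonneg fun i _ => Complex.normSq_nonneg _] at h1
    simpa using h1 i (Finset.mem_univ i)
  refine hp0 (hp.eq_zero_of_trace_eq_zero_s9 ?_)
  have := congrArg (fun x => (p * x).trace) (hpar 1 (one_mem D))
  simpa [Finset.mul_sum, Matrix.trace_sum, htr] using this.symm

/-- Polar decomposition inside a commutant: a nonzero element of the commutant yields a nonzero
partial isometry in the commutant with the same source and target constraints. -/
theorem exists_partialIsometry_of_commutant {n : Type} [Fintype n] [DecidableEq n]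
    (D : StarSubalgebra ℂ (Matrix n n ℂ)) {p q t : Matrix n n ℂ} (ht0 : t ≠ 0)
    (htD : ∀ a ∈ D, Commute a t) (hp : IsStarProjection p) (htp : t * p = t) (hqt : q * t = t) :
    ∃ v : Matrix n n ℂ, v ≠ 0 ∧ (∀ a ∈ D, Commute a v) ∧ v * p = v ∧ q * v = v ∧
      v * star v * v = v := by
  let f : ℝ → ℝ := fun x => (√x)⁻¹
  let s := star t * t
  have hs : IsSelfAdjoint s := .star_mul_self t
  have hstD (a) (ha : a ∈ D) : Commute a (star t) := by
    simpa using (htD (star a) (star_mem ha)).star_star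
  have hcont (g : ℝ → ℝ) : ContinuousOn g (spectrum ℝ s) :=
    Matrix.finite_real_spectrum.continuousOn g
  have hspec (x : ℝ) (hx : x ∈ spectrum ℝ s) : 0 ≤ x := by
    open scoped MatrixOrder in
    exact spectrum_nonneg_of_nonneg (star_mul_self_nonneg t) hx
  have hf : star (cfc f s) = cfc f s := (cfc_predicate f s : IsSelfAdjoint _).star_eq
  have hsp : Commute p s := by
    have h1 : s * p = s := by rw [mul_assoc, htp]
    have h2 : p * s = s := by
      simpa [hs.star_eq, hp.isSelfAdjoint.star_eq] using congrArg star h1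
    rw [Commute, SemiconjBy, h1, h2]
  refine ⟨t * cfc f s, fun h => ht0 ?_, fun a ha => ?_, ?_, ?_, ?_⟩
  · have hsq : s * cfc f s * cfc Real.sqrt s = s := by
      conv_lhs => enter [1, 1]; rw [← cfc_id' ℝ s]
      rw [← cfc_mul _ _ _ (hcont _) (hcont _), ← cfc_mul _ _ _ (hcont _) (hcont _)]
      conv_rhs => rw [← cfc_id' ℝ s]
      refine cfc_congr fun x hx => ?_
      rcases (hspec x hx).eq_or_lt with rfl | h0
      · simp
      · have := (Real.sqrt_pos.2 h0).ne'
        simp [f, this]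
    have h0 : s = 0 := by
      rw [← hsq, mul_assoc (star t), h, mul_zero, zero_mul]
    open scoped ComplexOrder in
    exact Matrix.conjTranspose_mul_self_eq_zero.1 h0
  · exact (htD a ha).mul_right (((hstD a ha).mul_right (htD a ha)).symm.cfc_real f).symm
  · rw [mul_assoc, (hsp.symm.cfc_real f).eq, ← mul_assoc, htp]
  · rw [← mul_assoc, hqt]
  · have hfs : cfc f s * cfc f s * s * cfc f s = cfc f s := by
      conv_lhs => enter [1, 2]; rw [← cfc_id' ℝ s]
      rw [← cfc_mul _ _ _ (hcont _) (hcont _), ← cfc_mul _ _ _ (hcont _) (hcont _),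
        ← cfc_mul _ _ _ (hcont _) (hcont _)]
      refine cfc_congr fun x hx => ?_
      rcases (hspec x hx).eq_or_lt with rfl | h0
      · simp [f]
      · have h1 := (Real.sqrt_pos.2 h0).ne'
        have h2 := Real.sq_sqrt h0.le
        simp only [f]
        field_simp
        exact h2.symm
    calc t * cfc f s * star (t * cfc f s) * (t * cfc f s)
        = t * (cfc f s * cfc f s * s * cfc f s) := by
          simp only [star_mul, hf, mul_assoc, s]
      _ = t * cfc f s := by rw [hfs]

/-- Projections in the commutant of a star-subalgebra of matrices with equal trace functionals
are Murray-von Neumann equivalent in the commutant. -/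
theorem exists_mul_star_eq_of_trace_eq {n : Type} [Fintype n] [DecidableEq n]
    (D : StarSubalgebra ℂ (Matrix n n ℂ)) {p q : Matrix n n ℂ}
    (hp : IsStarProjection p) (hq : IsStarProjection q)
    (hpD : ∀ a ∈ D, Commute a p) (hqD : ∀ a ∈ D, Commute a q)
    (h : ∀ a ∈ D, (p * a).trace = (q * a).trace) :
    ∃ v : Matrix n n ℂ, (∀ a ∈ D, Commute a v) ∧ star v * v = p ∧ v * star v = q := by
  induction hR : LinearMap.range (Matrix.toLin' p) using WellFoundedLT.induction
    generalizing p q with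
  | ind R ih =>
  subst hR
  by_cases hp0 : p = 0
  · have hq0 : q = 0 := hq.eq_zero_of_trace_eq_zero_s9 (by simpa [hp0] using (h 1 (one_mem D)).symm)
    exact ⟨0, by simp, by simp [hp0], by simp [hq0]⟩
  obtain ⟨t, ht0, htD, htp, hqt⟩ := exists_commutant_ne_zero D hp hq hpD hqD h hp0
  obtain ⟨v, hv0, hvD, hvp, hqv, hvvv⟩ :=
    exists_partialIsometry_of_commutant D ht0 htD hp htp hqt
  have hvD' (a) (ha : a ∈ D) : Commute a (star v) := by
    simpa using (hvD (star a) (star_mem ha)).star_star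
  have hpv : p * star v = star v := by
    simpa [hp.isSelfAdjoint.star_eq] using congrArg star hvp
  have hvq : star v * q = star v := by
    simpa [hq.isSelfAdjoint.star_eq] using congrArg star hqv
  have hsvvv : star v * v * star v = star v := by
    simpa [mul_assoc] using congrArg star hvvv
  have hp' : IsStarProjection (p - star v * v) := by
    refine ⟨?_, hp.isSelfAdjoint.sub (.star_mul_self v)⟩
    rw [IsIdempotentElem, sub_mul, mul_sub, mul_sub, hp.isIdempotentElem.eq, ← mul_assoc p, hpv,
      mul_assoc _ v p, hvp, ← mul_assoc (star v * v), hsvvv]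
    abel
  have hq' : IsStarProjection (q - v * star v) := by
    refine ⟨?_, hq.isSelfAdjoint.sub (.mul_star_self v)⟩
    rw [IsIdempotentElem, sub_mul, mul_sub, mul_sub, hq.isIdempotentElem.eq, ← mul_assoc q, hqv,
      mul_assoc _ _ q, hvq, ← mul_assoc (v * star v), hvvv]
    abel
  have hpp' : p * (p - star v * v) = p - star v * v := by
    rw [mul_sub, hp.isIdempotentElem.eq, ← mul_assoc, hpv]
  have hlt : LinearMap.range (Matrix.toLin' (p - star v * v))
      < LinearMap.range (Matrix.toLin' p) := by
    refine lt_of_le_of_ne ?_ fun heq => hv0 ?_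
    · rw [← hpp', Matrix.toLin'_mul]
      exact LinearMap.range_comp_le_range _ _
    · have hfix : (p - star v * v) * p = p := by
        apply Matrix.toLin'.injective
        refine LinearMap.ext fun x => ?_
        obtain ⟨y, hy⟩ : Matrix.toLin' p x ∈ LinearMap.range (Matrix.toLin' (p - star v * v)) :=
          heq ▸ LinearMap.mem_range_self _ x
        rw [Matrix.toLin'_mul_apply, ← hy, ← Matrix.toLin'_mul_apply, hp'.isIdempotentElem.eq]
      rw [sub_mul, hp.isIdempotentElem.eq, mul_assoc, hvp, sub_eq_self] at hfix
      rw [← hvvv, mul_assoc, hfix, mul_zero]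
  have htr (a) (ha : a ∈ D) :
      ((p - star v * v) * a).trace = ((q - v * star v) * a).trace := by
    rw [sub_mul, sub_mul, Matrix.trace_sub, Matrix.trace_sub, h a ha, mul_assoc (star v),
      Matrix.trace_mul_comm (star v), ← (hvD a ha).eq, mul_assoc, Matrix.trace_mul_comm a]
  obtain ⟨w, hwD, hw, hw'⟩ := ih _ hlt hp' hq'
    (fun a ha => (hpD a ha).sub_right ((hvD' a ha).mul_right (hvD a ha)))
    (fun a ha => (hqD a ha).sub_right ((hvD a ha).mul_right (hvD' a ha))) htr rfl
  have hwv : w * star v = 0 := by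
    open scoped ComplexOrder in
    rw [← Matrix.conjTranspose_mul_self_eq_zero, ← star_eq_conjTranspose, star_mul, star_star,
      mul_assoc, ← mul_assoc (star w), hw, sub_mul, hpv, hsvvv, sub_self, mul_zero]
  have hwv' : star w * v = 0 := by
    open scoped ComplexOrder in
    rw [← Matrix.conjTranspose_mul_self_eq_zero, ← star_eq_conjTranspose, star_mul, star_star,
      mul_assoc, ← mul_assoc w, hw', sub_mul, hqv, hvvv, sub_self, mul_zero]
  have hvw : v * star w = 0 := by simpa using congrArg star hwv
  have hvw' : star v * w = 0 := by simpa using congrArg star hwv'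
  refine ⟨v + w, fun a ha => (hvD a ha).add_right (hwD a ha), ?_, ?_⟩
  · rw [star_add, add_mul, mul_add, mul_add, hwv', hvw', hw]
    abel
  · rw [star_add, add_mul, mul_add, mul_add, hwv, hvw, hw']
    abel

/-- The inclusion of the `k`-th block into a direct sum of coordinate spaces. -/
def blockInclusion {κ : Type} [DecidableEq κ] (d : κ → ℕ) (k : κ) :
    Matrix (Σ k, Fin (d k)) (Fin (d k)) ℂ :=
  Matrix.of fun i j => if i = ⟨k, j⟩ then 1 else 0

theorem conjTranspose_blockInclusion_mul_self {κ : Type} [Fintype κ] [DecidableEq κ] (d : κ → ℕ)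
    (k : κ) : (blockInclusion d k)ᴴ * blockInclusion d k = 1 := by
  ext i j
  simp [blockInclusion, Matrix.mul_apply, Matrix.one_apply, apply_ite, eq_comm]

theorem conjTranspose_blockInclusion_mul_of_ne {κ : Type} [Fintype κ] [DecidableEq κ] (d : κ → ℕ)
    {k l : κ} (h : k ≠ l) : (blockInclusion d k)ᴴ * blockInclusion d l = 0 := by
  ext i j
  simp [blockInclusion, Matrix.mul_apply, apply_ite, h.symm]

theorem sum_blockInclusion_mul_conjTranspose {κ : Type} [Fintype κ] [DecidableEq κ] (d : κ → ℕ) :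
    ∑ k, blockInclusion d k * (blockInclusion d k)ᴴ = 1 := by
  ext ⟨k, i⟩ ⟨l, j⟩
  rw [Matrix.sum_apply, Finset.sum_eq_single k]
  · by_cases h : k = l
    · subst h
      simp [blockInclusion, Matrix.mul_apply, Matrix.one_apply, apply_ite, eq_comm]
    · simp [blockInclusion, Matrix.mul_apply, h, Ne.symm h]
  · intro m _ hm
    simp [blockInclusion, Matrix.mul_apply, hm.symm]
  · simp

section DoubleBlock

variable {W : Type} [DecidableEq W] (d : W → ℕ)

/-- The inclusion of the `b`-th copy of the `v`-th block into two copies of a graded space. -/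
abbrev doubleInclusion (b : Bool) (v : W) :
    Matrix (Σ x : Bool × W, Fin (d x.2)) (Fin (d v)) ℂ :=
  blockInclusion (fun x : Bool × W => d x.2) (b, v)

/-- The matrix acting as `X b` from the `u`-th to the `v`-th block in the `b`-th copy. -/
def doubleBlock (u v : W) (X : Bool → Matrix (Fin (d v)) (Fin (d u)) ℂ) :
    Matrix (Σ x : Bool × W, Fin (d x.2)) (Σ x : Bool × W, Fin (d x.2)) ℂ :=
  ∑ b, doubleInclusion d b v * X b * (doubleInclusion d b u)ᴴ

theorem conjTranspose_doubleBlock (u v : W) (X : Bool → Matrix (Fin (d v)) (Fin (d u)) ℂ) :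
    (doubleBlock d u v X)ᴴ = doubleBlock d v u fun b => (X b)ᴴ := by
  simp [doubleBlock, Matrix.mul_assoc]

variable [Fintype W]

/-- The projection onto the `b`-th copy of a graded space. -/
def copyProjection (b : Bool) :
    Matrix (Σ x : Bool × W, Fin (d x.2)) (Σ x : Bool × W, Fin (d x.2)) ℂ :=
  ∑ v, doubleInclusion d b v * (doubleInclusion d b v)ᴴ

theorem conjTranspose_doubleInclusion_mul_self (b : Bool) (v : W) :
    (doubleInclusion d b v)ᴴ * doubleInclusion d b v = 1 :=
  conjTranspose_blockInclusion_mul_self _ _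

theorem conjTranspose_doubleInclusion_mul_of_ne {b c : Bool} {v w : W} (h : b ≠ c ∨ v ≠ w) :
    (doubleInclusion d b v)ᴴ * doubleInclusion d c w = 0 := by
  refine conjTranspose_blockInclusion_mul_of_ne _ fun h' => ?_
  simp only [Prod.mk.injEq] at h'
  tauto

theorem doubleBlock_mul_doubleInclusion (u v : W)
    (X : Bool → Matrix (Fin (d v)) (Fin (d u)) ℂ) (b : Bool) :
    doubleBlock d u v X * doubleInclusion d b u = doubleInclusion d b v * X b := by
  rw [doubleBlock, Matrix.sum_mul, Finset.sum_eq_single b]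
  · rw [Matrix.mul_assoc, conjTranspose_doubleInclusion_mul_self, Matrix.mul_one]
  · intro c _ hc
    rw [Matrix.mul_assoc, conjTranspose_doubleInclusion_mul_of_ne _ (.inl hc), Matrix.mul_zero]
  · simp

theorem doubleBlock_mul_doubleInclusion_of_ne {u v w : W} (h : u ≠ w)
    (X : Bool → Matrix (Fin (d v)) (Fin (d u)) ℂ) (b : Bool) :
    doubleBlock d u v X * doubleInclusion d b w = 0 := by
  rw [doubleBlock, Matrix.sum_mul]
  refine Finset.sum_eq_zero fun c _ => ?_
  rw [Matrix.mul_assoc, conjTranspose_doubleInclusion_mul_of_ne _ (.inr h), Matrix.mul_zero]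

theorem doubleBlock_mul (u v w : W) (Y : Bool → Matrix (Fin (d w)) (Fin (d v)) ℂ)
    (X : Bool → Matrix (Fin (d v)) (Fin (d u)) ℂ) :
    doubleBlock d v w Y * doubleBlock d u v X = doubleBlock d u w fun b => Y b * X b := by
  conv_lhs => rw [doubleBlock.eq_def d u v X]
  simp only [Finset.mul_sum, ← Matrix.mul_assoc, doubleBlock_mul_doubleInclusion]
  simp only [doubleBlock, Matrix.mul_assoc]

theorem doubleBlock_mul_of_ne {u v v' w : W} (h : v' ≠ v)
    (Y : Bool → Matrix (Fin (d w)) (Fin (d v')) ℂ)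
    (X : Bool → Matrix (Fin (d v)) (Fin (d u)) ℂ) :
    doubleBlock d v' w Y * doubleBlock d u v X = 0 := by
  conv_lhs => rw [doubleBlock.eq_def d u v X]
  simp only [Finset.mul_sum, ← Matrix.mul_assoc, doubleBlock_mul_doubleInclusion_of_ne d h,
    Matrix.zero_mul, Finset.sum_const_zero]

theorem copyProjection_mul_doubleInclusion (b : Bool) (v : W) :
    copyProjection d b * doubleInclusion d b v = doubleInclusion d b v := by
  rw [copyProjection, Matrix.sum_mul, Finset.sum_eq_single v]
  · rw [Matrix.mul_assoc, conjTranspose_doubleInclusion_mul_self, Matrix.mul_one]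
  · intro w _ hw
    rw [Matrix.mul_assoc, conjTranspose_doubleInclusion_mul_of_ne _ (.inr hw), Matrix.mul_zero]
  · simp

theorem copyProjection_mul_doubleInclusion_of_ne {b c : Bool} (h : b ≠ c) (v : W) :
    copyProjection d b * doubleInclusion d c v = 0 := by
  rw [copyProjection, Matrix.sum_mul]
  refine Finset.sum_eq_zero fun w _ => ?_
  rw [Matrix.mul_assoc, conjTranspose_doubleInclusion_mul_of_ne _ (.inl h), Matrix.mul_zero]

theorem isStarProjection_copyProjection (b : Bool) : IsStarProjection (copyProjection d b) := by
  constructor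
  · rw [IsIdempotentElem]
    conv_lhs => enter [2]; rw [copyProjection]
    simp only [Finset.mul_sum, ← Matrix.mul_assoc, copyProjection_mul_doubleInclusion]
    rfl
  · simp [IsSelfAdjoint, copyProjection, star_eq_conjTranspose]

theorem copyProjection_mul_doubleBlock (b : Bool) (u v : W)
    (X : Bool → Matrix (Fin (d v)) (Fin (d u)) ℂ) :
    copyProjection d b * doubleBlock d u v X =
      doubleInclusion d b v * X b * (doubleInclusion d b u)ᴴ := by
  rw [doubleBlock, Finset.mul_sum, Finset.sum_eq_single b]
  · simp only [← Matrix.mul_assoc, copyProjection_mul_doubleInclusion]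
  · intro c _ hc
    simp only [← Matrix.mul_assoc, copyProjection_mul_doubleInclusion_of_ne d hc.symm,
      Matrix.zero_mul]
  · simp

theorem commute_doubleBlock_copyProjection (b : Bool) (u v : W)
    (X : Bool → Matrix (Fin (d v)) (Fin (d u)) ℂ) :
    Commute (doubleBlock d u v X) (copyProjection d b) := by
  have h := congrArg conjTranspose (copyProjection_mul_doubleBlock d b v u fun b => (X b)ᴴ)
  simp only [conjTranspose_mul, conjTranspose_doubleBlock, conjTranspose_conjTranspose,
    ← star_eq_conjTranspose (copyProjection d b),
    (isStarProjection_copyProjection d b).isSelfAdjoint.star_eq] at h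
  rw [Commute, SemiconjBy, h, copyProjection_mul_doubleBlock, Matrix.mul_assoc]

theorem trace_copyProjection_mul_doubleBlock (b : Bool) (u : W)
    (X : Bool → Matrix (Fin (d u)) (Fin (d u)) ℂ) :
    (copyProjection d b * doubleBlock d u u X).trace = (X b).trace := by
  rw [copyProjection_mul_doubleBlock, Matrix.trace_mul_comm, ← Matrix.mul_assoc,
    conjTranspose_doubleInclusion_mul_self, Matrix.one_mul]

theorem trace_copyProjection_mul_doubleBlock_of_ne (b : Bool) {u v : W} (h : u ≠ v)
    (X : Bool → Matrix (Fin (d v)) (Fin (d u)) ℂ) :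
    (copyProjection d b * doubleBlock d u v X).trace = 0 := by
  rw [copyProjection_mul_doubleBlock, Matrix.trace_mul_comm, ← Matrix.mul_assoc,
    conjTranspose_doubleInclusion_mul_of_ne _ (.inr h), Matrix.zero_mul, Matrix.trace_zero]

theorem sum_doubleBlock_one : ∑ v, doubleBlock d v v (fun _ => 1) = 1 := by
  rw [← sum_blockInclusion_mul_conjTranspose, Fintype.sum_prod_type_right]
  simp only [doubleBlock, Matrix.mul_one]

end DoubleBlock

theorem pathMatrixC_nil {V : Type} [Quiver V] (d : V → ℕ)
    (A : ∀ u v : V, (u ⟶ v) → Matrix (Fin (d v)) (Fin (d u)) ℂ) (u : V) :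
    pathMatrixC d A (Path.nil : Path u u) = 1 := by
  rw [pathMatrixC]

theorem pathMatrixC_comp {V : Type} [Quiver V] (d : V → ℕ)
    (A : ∀ u v : V, (u ⟶ v) → Matrix (Fin (d v)) (Fin (d u)) ℂ) {u v w : V} (p : Path u v)
    (q : Path v w) : pathMatrixC d A (p.comp q) = pathMatrixC d A q * pathMatrixC d A p := by
  induction q with
  | nil => simp [pathMatrixC]
  | cons q e ih => simp [pathMatrixC, ih, Matrix.mul_assoc]

theorem pathMatrixC_toPath {V : Type} [Quiver V] (d : V → ℕ)
    (A : ∀ u v : V, (u ⟶ v) → Matrix (Fin (d v)) (Fin (d u)) ℂ) {u v : V} (e : u ⟶ v) :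
    pathMatrixC d A e.toPath = A u v e := by
  simp [Hom.toPath, pathMatrixC]

theorem pathMatrixC_reverse {W : Type} [Quiver W] [HasReverse W] (d : W → ℕ)
    (R : ∀ u v : W, (u ⟶ v) → Matrix (Fin (d v)) (Fin (d u)) ℂ)
    (hR : ∀ (u v : W) (e : u ⟶ v), R v u (Quiver.reverse e) = (R u v e)ᴴ) {u v : W}
    (p : Path u v) : pathMatrixC d R p.reverse = (pathMatrixC d R p)ᴴ := by
  induction p with
  | nil => simp [pathMatrixC]
  | cons p e ih =>
    rw [Path.reverse, pathMatrixC_comp, ih, pathMatrixC_toPath, pathMatrixC, conjTranspose_mul,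
      hR]

theorem doubledRepH_reverse {V : Type} [Quiver V] (d : V → ℕ)
    (A : ∀ u v : V, (u ⟶ v) → Matrix (Fin (d v)) (Fin (d u)) ℂ) (u v : Symmetrify V)
    (e : u ⟶ v) : doubledRepH d A v u (Quiver.reverse e) = (doubledRepH d A u v e)ᴴ := by
  rcases e with a | a
  · rfl
  · exact (conjTranspose_conjTranspose _).symm

/-- Two matrix representations of a quiver, whose path matrices are simultaneously closed under
conjugate transposition and have equal traces on closed paths, are unitarily isometric. -/
theorem exists_unitary_intertwiner_of_trace_eq {W : Type} [Fintype W] [Quiver W] (d : W → ℕ)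
    (R : Bool → ∀ u v : W, (u ⟶ v) → Matrix (Fin (d v)) (Fin (d u)) ℂ)
    (hadj : ∀ (u v : W) (p : Path u v), ∃ p' : Path v u, ∀ b,
      pathMatrixC d (R b) p' = (pathMatrixC d (R b) p)ᴴ)
    (htr : ∀ (u : W) (p : Path u u),
      (pathMatrixC d (R true) p).trace = (pathMatrixC d (R false) p).trace) :
    ∃ U : ∀ v : W, Matrix (Fin (d v)) (Fin (d v)) ℂ, (∀ v, (U v)ᴴ * U v = 1) ∧
      ∀ (u v : W) (e : u ⟶ v), U v * R true u v e = R false u v e * U u := by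
  classical
  let M {u v : W} (p : Path u v) := doubleBlock d u v fun b => pathMatrixC d (R b) p
  let S : Set (Matrix (Σ x : Bool × W, Fin (d x.2)) (Σ x : Bool × W, Fin (d x.2)) ℂ) :=
    {x | ∃ (u v : W) (p : Path u v), M p = x}
  have hS {u v : W} (p : Path u v) : M p ∈ Submodule.span ℂ S :=
    Submodule.subset_span ⟨u, v, p, rfl⟩
  have hone : 1 ∈ Submodule.span ℂ S := by
    rw [← sum_doubleBlock_one]
    refine Submodule.sum_mem _ fun v _ => ?_
    simpa only [M, pathMatrixC] using hS (Path.nil : Path v v)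
  have hmul : Submodule.span ℂ S * Submodule.span ℂ S ≤ Submodule.span ℂ S := by
    rw [Submodule.span_mul_span, Submodule.span_le]
    rintro _ ⟨_, ⟨v', w, q, rfl⟩, _, ⟨u, v, p, rfl⟩, rfl⟩
    by_cases h : v' = v
    · subst h
      simpa only [M, doubleBlock_mul, ← pathMatrixC_comp, SetLike.mem_coe] using hS (p.comp q)
    · simp [M, doubleBlock_mul_of_ne d h]
  let D : StarSubalgebra ℂ
      (Matrix (Σ x : Bool × W, Fin (d x.2)) (Σ x : Bool × W, Fin (d x.2)) ℂ) :=
    { carrier := Submodule.span ℂ S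
      mul_mem' := fun ha hb => hmul (Submodule.mul_mem_mul ha hb)
      one_mem' := hone
      add_mem' := fun ha hb => add_mem ha hb
      zero_mem' := zero_mem _
      algebraMap_mem' := fun r => by
        rw [Algebra.algebraMap_eq_smul_one]
        exact Submodule.smul_mem _ _ hone
      star_mem' := fun {a} ha => by
        change star a ∈ Submodule.span ℂ S
        induction ha using Submodule.span_induction with
        | mem x hx =>
          obtain ⟨u, v, p, rfl⟩ := hx
          obtain ⟨p', hp'⟩ := hadj u v p
          simpa only [M, star_eq_conjTranspose, conjTranspose_doubleBlock, ← hp'] using hS p'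
        | zero => simp
        | add x y _ _ hx hy => simpa using add_mem hx hy
        | smul r x _ hx => simpa using Submodule.smul_mem _ _ hx }
  have hcomm (b : Bool) : ∀ a ∈ D, Commute a (copyProjection d b) := by
    intro a ha
    change a ∈ Submodule.span ℂ S at ha
    induction ha using Submodule.span_induction with
    | mem x hx =>
      obtain ⟨u, v, p, rfl⟩ := hx
      exact commute_doubleBlock_copyProjection d b u v _
    | zero => exact Commute.zero_left _
    | add x y _ _ hx hy => exact hx.add_left hy
    | smul r x _ hx => exact hx.smul_left r
  have htrace : ∀ a ∈ D,
      (copyProjection d true * a).trace = (copyProjection d false * a).trace := by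
    intro a ha
    change a ∈ Submodule.span ℂ S at ha
    induction ha using Submodule.span_induction with
    | mem x hx =>
      obtain ⟨u, v, p, rfl⟩ := hx
      by_cases h : u = v
      · subst h
        simp only [M, trace_copyProjection_mul_doubleBlock, htr]
      · simp only [M, trace_copyProjection_mul_doubleBlock_of_ne d _ h]
    | zero => simp
    | add x y _ _ hx hy => simp only [mul_add, Matrix.trace_add, hx, hy]
    | smul r x _ hx => simp only [mul_smul_comm, Matrix.trace_smul, hx]
  obtain ⟨w, hwD, hw, hw'⟩ := exists_mul_star_eq_of_trace_eq D
    (isStarProjection_copyProjection d true) (isStarProjection_copyProjection d false)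
    (hcomm true) (hcomm false) htrace
  have hid (v : W) : Commute (doubleBlock d v v fun _ => 1) w :=
    hwD _ (show _ ∈ Submodule.span ℂ S by
      simpa only [M, pathMatrixC] using hS (Path.nil : Path v v))
  have hrange (v : W) : doubleInclusion d false v * ((doubleInclusion d false v)ᴴ *
      (w * doubleInclusion d true v)) = w * doubleInclusion d true v := by
    have h1 := copyProjection_mul_doubleBlock d false v v fun _ => 1
    rw [Matrix.mul_one] at h1
    rw [← Matrix.mul_assoc, ← h1, Matrix.mul_assoc, ← Matrix.mul_assoc _ w, (hid v).eq,
      Matrix.mul_assoc w, doubleBlock_mul_doubleInclusion, Matrix.mul_one, ← hw',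
      Matrix.mul_assoc, ← Matrix.mul_assoc (star w), hw, copyProjection_mul_doubleInclusion]
  refine ⟨fun v => (doubleInclusion d false v)ᴴ * (w * doubleInclusion d true v),
    fun v => ?_, fun u v e => ?_⟩
  · rw [conjTranspose_mul, conjTranspose_conjTranspose, Matrix.mul_assoc, hrange,
      conjTranspose_mul, Matrix.mul_assoc, ← Matrix.mul_assoc wᴴ, ← star_eq_conjTranspose w, hw,
      copyProjection_mul_doubleInclusion, conjTranspose_doubleInclusion_mul_self]
  · have hM : M e.toPath = doubleBlock d u v fun b => R b u v e := by
      simp only [M, pathMatrixC_toPath]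
    have hMw := (hwD _ (hS e.toPath)).eq
    rw [hM] at hMw
    have hleft := congrArg conjTranspose
      (doubleBlock_mul_doubleInclusion d v u (fun b => (R b u v e)ᴴ) false)
    simp only [conjTranspose_mul, conjTranspose_doubleBlock, conjTranspose_conjTranspose] at hleft
    rw [Matrix.mul_assoc, Matrix.mul_assoc,
      ← doubleBlock_mul_doubleInclusion d u v (fun b => R b u v e) true, ← Matrix.mul_assoc w,
      ← hMw, Matrix.mul_assoc _ w, ← Matrix.mul_assoc, hleft, Matrix.mul_assoc]

theorem pathMatrixC_eq_of_unitary {W : Type} [Quiver W] (d : W → ℕ)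
    (A B : ∀ u v : W, (u ⟶ v) → Matrix (Fin (d v)) (Fin (d u)) ℂ)
    (U : ∀ v : W, Matrix (Fin (d v)) (Fin (d v)) ℂ) (hU : ∀ v, (U v)ᴴ * U v = 1)
    (h : ∀ (u v : W) (e : u ⟶ v), B u v e = (U v)ᴴ * A u v e * U u) {u v : W} (p : Path u v) :
    pathMatrixC d B p = (U v)ᴴ * pathMatrixC d A p * U u := by
  induction p with
  | nil => rw [pathMatrixC, pathMatrixC, Matrix.mul_one, hU]
  | @cons v w p e ih =>
    have hU' : U v * (U v)ᴴ = 1 := mul_eq_one_comm.1 (hU v)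
    rw [pathMatrixC, pathMatrixC, ih, h]
    simp only [Matrix.mul_assoc]
    rw [← Matrix.mul_assoc (U v), hU', Matrix.one_mul]

theorem trace_pathMatrixC_eq_of_unitary {W : Type} [Quiver W] (d : W → ℕ)
    (A B : ∀ u v : W, (u ⟶ v) → Matrix (Fin (d v)) (Fin (d u)) ℂ)
    (U : ∀ v : W, Matrix (Fin (d v)) (Fin (d v)) ℂ) (hU : ∀ v, (U v)ᴴ * U v = 1)
    (h : ∀ (u v : W) (e : u ⟶ v), B u v e = (U v)ᴴ * A u v e * U u) {u : W} (p : Path u u) :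
    (pathMatrixC d A p).trace = (pathMatrixC d B p).trace := by
  rw [pathMatrixC_eq_of_unitary d A B U hU h, Matrix.mul_assoc, Matrix.trace_mul_comm,
    Matrix.mul_assoc, mul_eq_one_comm.1 (hU u), Matrix.mul_one]

theorem doubledRepH_eq_of_unitary {V : Type} [Quiver V] (d : V → ℕ)
    (A B : ∀ u v : V, (u ⟶ v) → Matrix (Fin (d v)) (Fin (d u)) ℂ)
    (U : ∀ v : V, Matrix (Fin (d v)) (Fin (d v)) ℂ)
    (h : ∀ (u v : V) (e : u ⟶ v), B u v e = (U v)ᴴ * A u v e * U u) (u v : Symmetrify V)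
    (e : u ⟶ v) : doubledRepH d B u v e = (U v)ᴴ * doubledRepH d A u v e * U u := by
  rcases e with a | a
  · exact h _ _ a
  · refine (congrArg conjTranspose (h _ _ a)).trans ?_
    rw [conjTranspose_mul, conjTranspose_mul, conjTranspose_conjTranspose, ← Matrix.mul_assoc]
    rfl


/-- **Specht's criterion for complex matrix representations of a quiver**
(Futorny–Horn–Sergeichuk, Theorem 2, unitary case).  Two complex matrix representations
`A`, `B` of the same dimension `d` of a quiver with finitely many vertices and arrows are
unitarily isometric iff the traces of all oriented cycles (closed directed walks of
positive length) in the doubled quiver coincide for the induced representations `Ã`, `B̃`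
(which assign the conjugate transpose matrices to the reversed arrows). -/
theorem matrixRep_unitarily_isometric_iff_traces {V : Type} [Fintype V] [Quiver V]
    [∀ u v : V, Fintype (u ⟶ v)] (d : V → ℕ)
    (A B : ∀ u v : V, (u ⟶ v) → Matrix (Fin (d v)) (Fin (d u)) ℂ) :
    (∃ U : ∀ v : V, Matrix (Fin (d v)) (Fin (d v)) ℂ,
      (∀ v : V, (U v)ᴴ * U v = 1) ∧
      ∀ (u v : V) (e : u ⟶ v), B u v e = (U v)⁻¹ * A u v e * U u) ↔
    (∀ (u : Symmetrify V) (p : Path u u), 0 < p.length →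
      (pathMatrixC (V := Symmetrify V) d (doubledRepH d A) p).trace =
      (pathMatrixC (V := Symmetrify V) d (doubledRepH d B) p).trace) := by
  constructor
  · rintro ⟨U, hU, h⟩ u p -
    refine trace_pathMatrixC_eq_of_unitary (W := Symmetrify V) d _ _ U hU
      (doubledRepH_eq_of_unitary d A B U fun u v e => ?_) p
    rw [h, Matrix.inv_eq_left_inv (hU v)]
  · intro h
    have : Fintype (Symmetrify V) := inferInstanceAs (Fintype V)
    obtain ⟨U, hU, hUR⟩ := exists_unitary_intertwiner_of_trace_eq (W := Symmetrify V) d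
      (fun b => doubledRepH d (if b then B else A))
      (fun u v p => ⟨p.reverse, fun b =>
        pathMatrixC_reverse (W := Symmetrify V) d _ (doubledRepH_reverse d _) p⟩)
      (fun u p => by
        cases p with
        | nil =>
          exact congrArg Matrix.trace ((pathMatrixC_nil (V := Symmetrify V) d _ u).trans
            (pathMatrixC_nil (V := Symmetrify V) d _ u).symm)
        | cons p e => exact (h u (p.cons e) (by simp)).symm)
    refine ⟨U, hU, fun u v e => ?_⟩
    have h' : U v * B u v e = A u v e * U u := hUR u v (Sum.inl e)
    have hv : (U v)ᴴ * U v = 1 := hU v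
    calc B u v e = (U v)ᴴ * U v * B u v e := by rw [hv, Matrix.one_mul]
      _ = (U v)⁻¹ * A u v e * U u := by
        rw [Matrix.inv_eq_left_inv hv, Matrix.mul_assoc, Matrix.mul_assoc]
        exact congrArg _ h'
end
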